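/- Let A be a simple σ-unital C*-algebra with real rank zero, and let α : G → Aut(A) be an action of a finite group G on A with the tracial Rokhlin property. Then the fixed point algebra A^α = {a ∈ A : α_g(a) = a for all g ∈ G} has real rank zero. -/

import Mathlib

open Filter Topology

/-- Cuntz subequivalence `a ≾ b` in a C*-algebra. -/
def CuntzSubeq {A : Type*} [NonUnitalCStarAlgebra A] (a b : A) : Prop :=
  ∃ v : ℕ → A, Tendsto (fun n => ‖a - v n * b * star (v n)‖) atTop (nhds 0)

/-- A projection in a C*-algebra: a self-adjoint idempotent. -/
def IsProjection {A : Type*} [NonUnitalCStarAlgebra A] (p : A) : Prop :=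
  IsSelfAdjoint p ∧ p * p = p

/-- A C*-algebra is simple if it is nonzero and its only closed two-sided ideals
are `⊥` and `⊤`. -/
def IsSimpleCStarAlgebra (A : Type*) [NonUnitalCStarAlgebra A] : Prop :=
  (∃ a : A, a ≠ 0) ∧ ∀ I : TwoSidedIdeal A, IsClosed (I : Set A) → I = ⊥ ∨ I = ⊤

/-- `(c - ε)₊`, via the (non-unital) continuous functional calculus. -/
noncomputable def cutPos {A : Type*} [NonUnitalCStarAlgebra A] (c : A) (ε : ℝ) : A :=
  cfcₙ (fun t : ℝ => max (t - ε) 0) c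

/-- The tracial Rokhlin property for an action of a finite group `G` on a C*-algebra `A`. -/
def TracialRokhlinProperty {A : Type*} [NonUnitalCStarAlgebra A] [PartialOrder A]
    [StarOrderedRing A] {G : Type*} [Group G] [Fintype G]
    (α : G → A ≃⋆ₐ[ℂ] A) : Prop :=
  ∀ (F : Finset A) (ε : ℝ), 0 < ε → ∀ x y : A, 0 ≤ x → 0 ≤ y → ‖x‖ = 1 →
    ∃ p : G → A,
      (∀ g, IsProjection (p g)) ∧
      (∀ g h, g ≠ h → p g * p h = 0) ∧
      (∀ a ∈ F, ∀ g, ‖p g * a - a * p g‖ < ε) ∧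
      (∀ g h, ‖α g (p h) - p (g * h)‖ < ε) ∧
      CuntzSubeq (cutPos (y * y - y * (∑ g, p g) * y) ε) x ∧
      ‖(∑ g, p g) * x * (∑ g, p g)‖ > 1 - ε


/-- A C*-algebra is σ-unital if it has a strictly positive element `h`, i.e. a positive `h`
with `closure (h A h) = A`. -/
def SigmaUnital (A : Type*) [NonUnitalCStarAlgebra A] [PartialOrder A] [StarOrderedRing A] :
    Prop :=
  ∃ h : A, 0 ≤ h ∧ closure {x : A | ∃ a : A, x = h * a * h} = Set.univ

/-- A C*-algebra `B` has real rank zero if the invertible self-adjoint elements of its minimal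
unitization are dense in the self-adjoint elements of the unitization. -/
def RealRankZero (B : Type*) [NonUnitalCStarAlgebra B] : Prop :=
  ∀ x : Unitization ℂ B, IsSelfAdjoint x → ∀ ε : ℝ, 0 < ε →
    ∃ y : Unitization ℂ B, IsSelfAdjoint y ∧ IsUnit y ∧ ‖x - y‖ < ε

/-- The fixed point algebra `A^α` of a family of *-automorphisms, as a non-unital star
subalgebra of `A`. -/
def fixedPointAlgebra {A : Type*} [NonUnitalCStarAlgebra A] {G : Type*}
    (α : G → A ≃⋆ₐ[ℂ] A) : NonUnitalStarSubalgebra ℂ A where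
  carrier := {a : A | ∀ g : G, α g a = a}
  add_mem' := fun {a b} ha hb g => by rw [map_add, ha g, hb g]
  zero_mem' := fun g => map_zero (α g)
  mul_mem' := fun {a b} ha hb g => by rw [map_mul, ha g, hb g]
  smul_mem' := fun c a ha g => by rw [map_smul, ha g]
  star_mem' := fun {a} ha g => by rw [map_star, ha g]

instance fixedPointAlgebra_isClosed {A : Type*} [NonUnitalCStarAlgebra A] {G : Type*}
    (α : G → A ≃⋆ₐ[ℂ] A) : IsClosed ((fixedPointAlgebra α : NonUnitalStarSubalgebra ℂ A) : Set A) := by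
  have h : ((fixedPointAlgebra α : NonUnitalStarSubalgebra ℂ A) : Set A) =
      ⋂ g : G, {a : A | α g a = a} := by
    ext a
    simp [fixedPointAlgebra, Set.mem_iInter]
    rfl
  rw [h]
  exact isClosed_iInter fun g =>
    isClosed_eq ((NonUnitalStarAlgHom.isometry (α g) (α g).injective).continuous) continuous_id

section Basics

variable {U : Type*} [CStarAlgebra U] [PartialOrder U] [StarOrderedRing U]

lemma norm_mul_le_of_star_mul_self_le {x y : U} {C : ℝ} (hC : 0 ≤ C)
    (h : star x * x ≤ (C ^ 2) • (star y * y)) (q : U) : ‖x * q‖ ≤ C * ‖y * q‖ := by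
  have h1 := star_left_conjugate_le_conjugate h q
  have h2 : ‖star (x * q) * (x * q)‖ ≤ ‖(C ^ 2) • (star (y * q) * (y * q))‖ := by
    refine CStarAlgebra.norm_le_norm_of_nonneg_of_le (star_mul_self_nonneg _) ?_
    simpa [mul_assoc] using h1
  rw [CStarRing.norm_star_mul_self, norm_smul, CStarRing.norm_star_mul_self, Real.norm_eq_abs,
    abs_of_nonneg (sq_nonneg C)] at h2
  refine le_of_sq_le_sq ?_ (by positivity)
  nlinarith

lemma norm_cfc_mul_sub_le {a : U} (ha : IsSelfAdjoint a) {f : ℝ → ℝ} {t C : ℝ}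
    (hf : ContinuousOn f (spectrum ℝ a)) (hC : 0 ≤ C)
    (h : ∀ s ∈ spectrum ℝ a, |f s - f t| ≤ C * |s - t|) (q : U) :
    ‖cfc f a * q - f t • q‖ ≤ C * ‖a * q - t • q‖ := by
  have h1 : cfc f a * q - f t • q = cfc (fun s => f s - f t) a * q := by
    rw [cfc_sub .., cfc_const .., sub_mul, Algebra.algebraMap_eq_smul_one, smul_mul_assoc, one_mul]
  have h2 : a * q - t • q = cfc (fun s => s - t) a * q := by
    rw [cfc_sub .., cfc_const .., sub_mul, Algebra.algebraMap_eq_smul_one, smul_mul_assoc, one_mul,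
      cfc_id' ℝ a]
  rw [h1, h2]
  refine norm_mul_le_of_star_mul_self_le hC ?_ q
  rw [(cfc_predicate (R := ℝ) (p := IsSelfAdjoint) _ a : IsSelfAdjoint _).star_eq,
    (cfc_predicate (R := ℝ) (p := IsSelfAdjoint) _ a : IsSelfAdjoint _).star_eq,
    ← cfc_mul .., ← cfc_mul .., ← cfc_smul ..]
  refine cfc_mono (fun s hs => ?_)
  have := h s hs
  have h3 : |f s - f t| ^ 2 ≤ (C * |s - t|) ^ 2 := by gcongr
  rw [mul_pow, sq_abs, sq_abs] at h3
  simp only [smul_eq_mul]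
  nlinarith

lemma cfc_mul_eq_smul {a : U} (ha : IsSelfAdjoint a) {f : ℝ → ℝ} {t C : ℝ}
    (hf : ContinuousOn f (spectrum ℝ a)) (hC : 0 ≤ C)
    (h : ∀ s ∈ spectrum ℝ a, |f s - f t| ≤ C * |s - t|) {q : U} (hq : a * q = t • q) :
    cfc f a * q = f t • q := by
  have := norm_cfc_mul_sub_le ha hf hC h q
  rw [hq, sub_self, norm_zero, mul_zero] at this
  exact sub_eq_zero.mp (norm_le_zero_iff.mp this)

end Basics

section Projections

variable {U : Type*} [CStarAlgebra U] [PartialOrder U] [StarOrderedRing U]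

omit [PartialOrder U] [StarOrderedRing U] in
/-- An almost idempotent self-adjoint element is close to a projection. -/
lemma exists_isStarProjection_near {a : U} (ha : IsSelfAdjoint a) {δ : ℝ}
    (h : ‖a * a - a‖ ≤ δ) (hδ : δ < 1 / 4) :
    ∃ q k : U, IsStarProjection q ∧ ‖q - a‖ ≤ 2 * δ ∧ q = k * a := by
  have hspec : ∀ t ∈ spectrum ℝ a, |t * t - t| ≤ δ := fun t ht => by
    have h1 : cfc (fun t : ℝ => t * t - t) a = a * a - a := by
      rw [cfc_sub .., cfc_mul .., cfc_id' ℝ a]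
    have h2 := norm_apply_le_norm_cfc (fun t : ℝ => t * t - t) a ht
    rw [h1] at h2
    exact h2.trans h
  have hne : ∀ t ∈ spectrum ℝ a, t ≠ 1 / 2 := by
    rintro t ht rfl
    have := hspec _ ht
    rw [abs_le] at this
    linarith [this.1]
  have hcont : ContinuousOn (fun t : ℝ => if 1 / 2 < t then (1 : ℝ) else 0) (spectrum ℝ a) := by
    intro t ht
    refine ContinuousAt.continuousWithinAt ?_
    rcases lt_or_gt_of_ne (hne t ht) with h | h
    · refine (continuousAt_const (y := (0 : ℝ))).congr ?_
      filter_upwards [gt_mem_nhds h] with s hs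
      rw [if_neg (not_lt.mpr hs.le)]
    · refine (continuousAt_const (y := (1 : ℝ))).congr ?_
      filter_upwards [lt_mem_nhds h] with s hs
      rw [if_pos hs]
  have hcont' : ContinuousOn (fun t : ℝ => if 1 / 2 < t then t⁻¹ else 0) (spectrum ℝ a) := by
    intro t ht
    refine ContinuousAt.continuousWithinAt ?_
    rcases lt_or_gt_of_ne (hne t ht) with h | h
    · refine (continuousAt_const (y := (0 : ℝ))).congr ?_
      filter_upwards [gt_mem_nhds h] with s hs
      rw [if_neg (not_lt.mpr hs.le)]
    · refine (continuousAt_inv₀ (by linarith : t ≠ 0)).congr ?_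
      filter_upwards [lt_mem_nhds h] with s hs
      rw [if_pos hs]
  refine ⟨cfc (fun t : ℝ => if 1 / 2 < t then (1 : ℝ) else 0) a,
    cfc (fun t : ℝ => if 1 / 2 < t then t⁻¹ else 0) a, ⟨?_, cfc_predicate _ a⟩, ?_, ?_⟩
  · rw [IsIdempotentElem, ← cfc_mul ..]
    exact cfc_congr fun t _ => by simp
  · conv_lhs => rw [← cfc_id' ℝ a, cfc_id' ℝ a]
    nth_rw 2 [← cfc_id' ℝ a]
    rw [← cfc_sub ..]
    refine norm_cfc_le (by linarith [norm_nonneg (a * a - a)]) fun t ht => ?_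
    have h1 := hspec t ht
    rw [abs_le] at h1
    rw [Real.norm_eq_abs, abs_le]
    split_ifs with h2 <;> constructor <;> nlinarith
  · nth_rw 3 [← cfc_id' ℝ a]
    rw [← cfc_mul ..]
    refine cfc_congr fun t _ => ?_
    split_ifs with h2
    · rw [inv_mul_cancel₀ (by linarith)]
    · simp

/-- The function `t ↦ max(t, 1/2)^(-1/2)`. -/
noncomputable def invSqrtCut (t : ℝ) : ℝ := (√(max t (1 / 2)))⁻¹

lemma sqrt_max_half_pos (t : ℝ) : 0 < √(max t (1 / 2)) :=
  Real.sqrt_pos.mpr (lt_of_lt_of_le (by norm_num) (le_max_right _ _))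

lemma continuous_invSqrtCut : Continuous invSqrtCut :=
  Continuous.inv₀ (by fun_prop) fun t => (sqrt_max_half_pos t).ne'

lemma invSqrtCut_mul_self (t : ℝ) : invSqrtCut t * invSqrtCut t = (max t (1 / 2))⁻¹ := by
  rw [invSqrtCut, ← mul_inv, Real.mul_self_sqrt (le_trans (by norm_num) (le_max_right _ _))]

lemma invSqrtCut_one : invSqrtCut 1 = 1 := by
  rw [invSqrtCut, max_eq_left (by norm_num)]; simp

lemma invSqrtCut_nonneg (t : ℝ) : 0 ≤ invSqrtCut t := inv_nonneg.mpr (Real.sqrt_nonneg _)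

lemma invSqrtCut_le_two (t : ℝ) : invSqrtCut t ≤ 2 := by
  refine abs_le_of_sq_le_sq' ?_ (by norm_num) |>.2
  rw [sq, invSqrtCut_mul_self]
  refine (inv_le_of_inv_le₀ (by norm_num) ?_)
  exact le_trans (by norm_num) (le_max_right _ _)

lemma abs_invSqrtCut_sub_one_le (t : ℝ) : |invSqrtCut t - 1| ≤ 2 * |t - 1| := by
  have h1 := invSqrtCut_mul_self t
  have h0 := invSqrtCut_nonneg t
  have h2 : |invSqrtCut t - 1| ≤ |invSqrtCut t * invSqrtCut t - 1| := by
    have : invSqrtCut t * invSqrtCut t - 1 = (invSqrtCut t - 1) * (invSqrtCut t + 1) := by ring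
    rw [this, abs_mul]
    refine le_mul_of_one_le_right (abs_nonneg _) ?_
    rw [abs_of_nonneg (by linarith)]
    linarith
  refine h2.trans ?_
  rw [h1]
  have hm : (1 / 2 : ℝ) ≤ max t (1 / 2) := le_max_right _ _
  have h3 : (max t (1 / 2))⁻¹ - 1 = (1 - max t (1 / 2)) * (max t (1 / 2))⁻¹ := by
    rw [sub_mul, mul_inv_cancel₀ (by linarith), one_mul]
  have h4 : (max t (1 / 2))⁻¹ ≤ 2 := inv_le_of_inv_le₀ (by norm_num) (by linarith)
  rw [h3, abs_mul, abs_of_nonneg (inv_nonneg.mpr (by linarith : 0 ≤ max t (1 / 2))), mul_comm]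
  refine mul_le_mul h4 ?_ (abs_nonneg _) (by norm_num)
  rcases le_total t (1 / 2) with h | h
  · rw [max_eq_right h, abs_of_nonneg (by norm_num), abs_of_nonpos (by linarith)]; linarith
  · rw [max_eq_left h, abs_sub_comm]

lemma eq_zero_of_le_half_add_sum {ι : Type*} [Fintype ι] {e : ι → ℝ} {δ : ℝ} (he : ∀ i, 0 ≤ e i)
    (hδ : Fintype.card ι * δ ≤ 1 / 4) (h : ∀ i, e i ≤ 1 / 2 * e i + δ * ∑ k, e k) (i : ι) :
    e i = 0 := by
  have h1 : ∑ i, e i ≤ 1 / 2 * ∑ i, e i + Fintype.card ι * δ * ∑ k, e k := by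
    refine (Finset.sum_le_sum fun i _ => h i).trans_eq ?_
    rw [Finset.sum_add_distrib, ← Finset.mul_sum, Finset.sum_const, nsmul_eq_mul,
      Finset.card_univ, mul_assoc]
  have h2 : 0 ≤ ∑ i, e i := Finset.sum_nonneg fun i _ => he i
  have h3 : ∑ i, e i = 0 := by nlinarith
  exact (Finset.sum_eq_zero_iff_of_nonneg fun i _ => he i).mp h3 i (Finset.mem_univ i)

variable {ι : Type*} [Fintype ι] [DecidableEq ι]

omit [PartialOrder U] [StarOrderedRing U] in
lemma norm_sum_erase_le {p D : ι → U} {δ : ℝ} (hδ0 : 0 ≤ δ)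
    (hd : ∀ i j, i ≠ j → ‖p i * p j‖ ≤ δ) (j : ι) :
    ‖∑ k ∈ Finset.univ.erase j, D k * (p k * p j)‖ ≤ δ * ∑ k, ‖D k‖ := by
  refine (norm_sum_le _ _).trans ?_
  rw [Finset.mul_sum]
  refine (Finset.sum_le_sum (g := fun k => δ * ‖D k‖) fun k hk => ?_).trans
    (Finset.sum_le_sum_of_subset_of_nonneg (Finset.subset_univ _) fun k _ _ => by positivity)
  rw [mul_comm δ]
  exact (norm_mul_le _ _).trans
    (mul_le_mul_of_nonneg_left (hd k j (Finset.ne_of_mem_erase hk)) (norm_nonneg _))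

/-- Symmetric orthogonalization of an almost orthogonal family of projections. -/
lemma mul_cfc_invSqrtCut_mul {p : ι → U} (hp : ∀ i, IsStarProjection (p i)) {δ : ℝ} (hδ0 : 0 ≤ δ)
    (hd : ∀ i j, i ≠ j → ‖p i * p j‖ ≤ δ) (hδ : Fintype.card ι * δ ≤ 1 / 4) (i j : ι) :
    p i * (cfc invSqrtCut (∑ k, p k) * cfc invSqrtCut (∑ k, p k)) * p j =
      if i = j then p i else 0 := by
  set S := ∑ k, p k with hS
  have hS0 : 0 ≤ S := Finset.sum_nonneg fun k _ => (hp k).nonneg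
  have hSsa : IsSelfAdjoint S := .of_nonneg hS0
  have hsp : ∀ t ∈ spectrum ℝ S, 0 ≤ t := fun t ht => spectrum_nonneg_of_nonneg hS0 ht
  have hpp : ∀ k, p k * p k = p k := fun k => (hp k).isIdempotentElem
  set X := cfc (fun t : ℝ => max 0 (1 - 2 * t)) S with hX
  set W := cfc invSqrtCut S * cfc invSqrtCut S with hW
  have hWS : W * S = 1 - X := by
    have hc := continuous_invSqrtCut
    have h1 : W * S = W * cfc (fun t : ℝ => t) S := by rw [cfc_id' ℝ S]
    rw [h1, hW, ← cfc_mul .., ← cfc_mul .., hX, ← cfc_one ℝ S, ← cfc_sub ..]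
    refine cfc_congr fun t ht => ?_
    have ht0 := hsp t ht
    simp only [invSqrtCut_mul_self, Pi.one_apply]
    rcases le_total t (1 / 2) with h | h
    · rw [max_eq_right h, max_eq_right (by linarith)]; ring
    · rw [max_eq_left h, max_eq_left (by linarith), inv_mul_cancel₀ (by linarith)]; ring
  have hXS : X * S = S * X := by
    have : Commute (cfc (fun t : ℝ => max 0 (1 - 2 * t)) S) (cfc (fun t : ℝ => t) S) :=
      cfc_commute_cfc _ _ S
    rwa [cfc_id' ℝ S] at this
  have hXp : ∀ k, X * p k = 0 := by
    have hle : star (S * X) * (S * X) ≤ ((1 / 2 : ℝ) ^ 2) • (star X * X) := by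
      have hXsa : IsSelfAdjoint X := cfc_predicate _ S
      have hSX : S * X = cfc (fun t : ℝ => t * max 0 (1 - 2 * t)) S := by
        rw [cfc_mul .., cfc_id' ℝ S]
      have hSXsa : IsSelfAdjoint (S * X) := by rw [hSX]; exact cfc_predicate _ S
      rw [hSXsa.star_eq, hXsa.star_eq, hSX, hX, ← cfc_mul .., ← cfc_mul .., ← cfc_smul ..]
      refine cfc_mono fun t ht => ?_
      have ht0 := hsp t ht
      simp only [smul_eq_mul]
      rcases le_total t (1 / 2) with h | h
      · have : t ^ 2 ≤ (1 / 2) ^ 2 := by gcongr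
        nlinarith [mul_self_nonneg (max 0 (1 - 2 * t))]
      · rw [max_eq_left (by linarith)]; simp
    intro k
    rw [← norm_eq_zero]
    refine eq_zero_of_le_half_add_sum (e := fun k => ‖X * p k‖) (fun _ => norm_nonneg _) hδ
      (fun j => ?_) k
    have h1 : X * p j = S * X * p j - ∑ k ∈ Finset.univ.erase j, X * p k * (p k * p j) := by
      rw [← hXS, hS, Finset.mul_sum, Finset.sum_mul,
        ← Finset.add_sum_erase _ _ (Finset.mem_univ j), mul_assoc X, hpp]
      rw [add_sub_assoc, ← Finset.sum_sub_distrib]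
      have h5 : ∀ k, X * p k * p j - X * p k * (p k * p j) = 0 := fun k => by
        rw [← mul_assoc, mul_assoc X (p k) (p k), hpp, sub_self]
      rw [Finset.sum_congr rfl fun k _ => h5 k, Finset.sum_const_zero, add_zero]
    have h2 := norm_mul_le_of_star_mul_self_le (by norm_num) hle (p j)
    have h3 := norm_sum_erase_le (D := fun k => X * p k) hδ0 hd j
    have h4 := norm_sub_le (S * X * p j) (∑ k ∈ Finset.univ.erase j, X * p k * (p k * p j))
    rw [← h1] at h4
    linarith
  have hD : ∀ j, p i * W * p j - (if i = j then p i else 0) = 0 := by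
    intro j
    rw [← norm_eq_zero]
    refine eq_zero_of_le_half_add_sum (e := fun j => ‖p i * W * p j - (if i = j then p i else 0)‖)
      (fun _ => norm_nonneg _) hδ (fun j => ?_) j
    have hsum : ∑ k, (p i * W * p k - (if i = k then p i else 0)) * (p k * p j) = 0 := by
      have h1 : ∀ k, (p i * W * p k - (if i = k then p i else 0)) * (p k * p j) =
          p i * W * p k * p j - (if i = k then p i * p j else 0) := fun k => by
        split_ifs with h
        · subst h
          rw [sub_mul, mul_assoc (p i * W), ← mul_assoc (p i) (p i) (p j), hpp,
            ← mul_assoc (p i * W)]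
        · rw [sub_zero, sub_zero, ← mul_assoc, mul_assoc _ (p k) (p k), hpp]
      rw [Finset.sum_congr rfl fun k _ => h1 k, Finset.sum_sub_distrib, ← Finset.sum_mul,
        ← Finset.mul_sum, ← hS, mul_assoc (p i), hWS, mul_sub, mul_one, sub_mul, mul_assoc (p i),
        hXp, Finset.sum_ite_eq]
      simp
    rw [← Finset.add_sum_erase _ _ (Finset.mem_univ j), hpp] at hsum
    have h2 : (p i * W * p j - (if i = j then p i else 0)) * p j =
        p i * W * p j - (if i = j then p i else 0) := by
      rw [sub_mul, mul_assoc, hpp]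
      split_ifs with h
      · subst h; rw [hpp]
      · simp
    rw [h2] at hsum
    have h3 := norm_sum_erase_le (D := fun k => p i * W * p k - (if i = k then p i else 0))
      hδ0 hd j
    rw [eq_neg_of_add_eq_zero_left hsum, norm_neg]
    refine h3.trans ?_
    have := norm_nonneg (∑ k ∈ Finset.univ.erase j,
      (p i * W * p k - (if i = k then p i else 0)) * (p k * p j))
    linarith
  exact sub_eq_zero.mp (hD j)

end Projections

section Corners

variable {U : Type*} [CStarAlgebra U]

lemma IsStarProjection.norm_conj_le {p : U} (hp : IsStarProjection p) (x : U) :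
    ‖p * x * p‖ ≤ ‖x‖ := by
  have h1 := hp.norm_le
  calc ‖p * x * p‖ ≤ ‖p‖ * ‖x‖ * ‖p‖ := norm_mul₃_le
    _ ≤ 1 * ‖x‖ * 1 := by gcongr
    _ = ‖x‖ := by ring

/-- Corners of a C*-algebra of real rank zero by projections have real rank zero. -/
lemma exists_invertible_in_corner
    (hRR : ∀ x : U, IsSelfAdjoint x → ∀ ε : ℝ, 0 < ε →
      ∃ y : U, IsSelfAdjoint y ∧ IsUnit y ∧ ‖x - y‖ < ε)
    {p x : U} (hp : IsStarProjection p) (hx : IsSelfAdjoint x) (hpx : p * x * p = x)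
    {ε : ℝ} (hε : 0 < ε) :
    ∃ z z' : U, IsSelfAdjoint z ∧ p * z = z ∧ z * p = z ∧ p * z' = z' ∧ z' * p = z' ∧
      z * z' = p ∧ z' * z = p ∧ ‖z - x‖ < ε := by
  have hpp : p * p = p := hp.isIdempotentElem
  have hps : star p = p := hp.isSelfAdjoint
  set q := 1 - p with hq
  have hqp : IsStarProjection q := hp.one_sub
  have hqq : q * q = q := hqp.isIdempotentElem
  have hqs : star q = q := hqp.isSelfAdjoint
  have hpq : p * q = 0 := hp.mul_one_sub_self
  have hqp0 : q * p = 0 := hp.one_sub_mul_self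
  have hpq1 : p + q = 1 := by rw [hq]; abel
  have hxp : x * p = x := by rw [← hpx, mul_assoc, hpp]
  have hpx' : p * x = x := by rw [← hpx, mul_assoc p x p, ← mul_assoc, hpp]
  have hxq : x * q = 0 := by rw [← hxp, mul_assoc, hpq, mul_zero]
  set δ := min (ε / 3) (1 / 2) with hδ
  have hδ0 : 0 < δ := lt_min (by linarith) (by norm_num)
  have hδ1 : δ ≤ 1 / 2 := min_le_right _ _
  have hδ2 : δ ≤ ε / 3 := min_le_left _ _
  obtain ⟨T, hTs, ⟨u, rfl⟩, hT⟩ := hRR (x + q) (hx.add hqp.isSelfAdjoint) δ hδ0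
  obtain ⟨E, hE⟩ : ∃ E : U, E = (u : U) - (x + q) := ⟨_, rfl⟩
  have hT' : (u : U) = x + q + E := by rw [hE]; abel
  have hEn : ‖E‖ < δ := by rw [hE, norm_sub_rev]; exact hT
  have hDu : IsUnit (q * u * q + p) := by
    have h1 : q * u * q + p = 1 - (-(q * E * q)) := by
      rw [hT', ← hpq1]
      simp only [mul_add, add_mul, hqq, mul_assoc, hxq, mul_zero]
      abel
    rw [h1]
    refine isUnit_one_sub_of_norm_lt_one ?_
    rw [norm_neg]
    linarith [hqp.norm_conj_le E]
  obtain ⟨D, hD⟩ := hDu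
  have hD1 : (D : U) = 1 + q * E * q := by
    rw [hD, hT', ← hpq1]
    simp only [mul_add, add_mul, hqq, mul_assoc, hxq, mul_zero]
    abel
  have hDs : IsSelfAdjoint (D : U) := by
    rw [hD, isSelfAdjoint_iff]
    simp only [star_add, star_mul, hqs, hps, hTs.star_eq, mul_assoc]
  set Di : U := ↑D⁻¹ with hDi
  have hDDi : D * Di = 1 := D.mul_inv
  have hDiD : Di * D = 1 := D.inv_mul
  have hDis : star Di = Di := by
    have h1 : star Di * D = 1 := by
      have := congrArg star hDDi
      rwa [star_mul, hDs.star_eq, star_one] at this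
    calc star Di = star Di * (D * Di) := by rw [hDDi, mul_one]
      _ = Di := by rw [← mul_assoc, h1, one_mul]
  have hDp : (D : U) * p = p := by
    rw [hD, add_mul, mul_assoc, hqp0, mul_zero, zero_add, hpp]
  have hDip : Di * p = p := by
    calc Di * p = Di * (D * p) := by rw [hDp]
      _ = p := by rw [← mul_assoc, hDiD, one_mul]
  have hpDi : p * Di = p := by
    have := congrArg star hDip
    rwa [star_mul, hDis, hps] at this
  have hDiq : Di * q = q * Di := by
    rw [hq, mul_sub, sub_mul, mul_one, one_mul, hDip, hpDi]
  have hqDiq : q * Di * q = Di * q := by rw [← hDiq, mul_assoc, hqq]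
  have hDin : ‖Di‖ ≤ 2 := by
    have h1 : Di = 1 - Di * (q * E * q) := by
      have : Di * D = Di + Di * (q * E * q) := by rw [hD1, mul_add, mul_one]
      rw [hDiD] at this
      rw [this]; abel
    have h2 : ‖(1 : U)‖ ≤ 1 := IsStarProjection.norm_le 1 (.one U)
    have h3 : ‖Di * (q * E * q)‖ ≤ ‖Di‖ * (1 / 2) := (norm_mul_le _ _).trans
      (mul_le_mul_of_nonneg_left (by linarith [hqp.norm_conj_le E]) (norm_nonneg _))
    have h4 := norm_sub_le (1 : U) (Di * (q * E * q))
    rw [← h1] at h4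
    linarith
  set L := p * u * q * Di with hL
  set z := p * u * p - L * q * u * p with hz
  have hpz : p * z = z := by
    simp only [hz, hL, mul_sub, ← mul_assoc, hpp]
  have hzp : z * p = z := by
    simp only [hz, sub_mul, mul_assoc, hpp]
  have hzs : IsSelfAdjoint z := by
    rw [isSelfAdjoint_iff, hz, hL]
    simp only [star_sub, star_mul, hqs, hps, hTs.star_eq, hDis, mul_assoc]
  have hzT : z = (p - L) * u := by
    have h1 : (p - L) * u * q = 0 := by
      have h2 : L * u * q = p * u * q := by
        have h3 : L = L * q := by
          rw [hL, mul_assoc (p * (u : U) * q) Di q, hDiq, ← mul_assoc, mul_assoc (p * (u : U)) q q,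
            hqq]
        have h4 : q * u * q = D * q := by
          rw [hD, add_mul, hpq, add_zero, mul_assoc (q * (u : U)), hqq]
        calc L * u * q = L * (q * u * q) := by
              conv_lhs => rw [h3]
              simp only [mul_assoc]
          _ = p * u * q * (Di * D) * q := by rw [h4, hL]; simp only [mul_assoc]
          _ = p * u * q := by rw [hDiD, mul_one, mul_assoc, hqq]
      rw [sub_mul, sub_mul, h2, sub_self]
    have h5 : L * p = 0 := by
      rw [hL, mul_assoc, hDip, mul_assoc, hqp0, mul_zero]
    have h6 : L * q = L := by
      rw [hq, mul_sub, mul_one, h5, sub_zero]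
    calc z = (p - L) * u * p := by rw [hz, h6, sub_mul, sub_mul]
      _ = (p - L) * u * (p + q) := by rw [mul_add, h1, add_zero]
      _ = (p - L) * u := by rw [hpq1, mul_one]
  have hzz' : z * (p * ↑u⁻¹ * p) = p := by
    have h5 : L * p = 0 := by
      rw [hL, mul_assoc, hDip, mul_assoc, hqp0, mul_zero]
    rw [← mul_assoc, ← mul_assoc, hzp, hzT, mul_assoc (p - L), u.mul_inv, mul_one, sub_mul, h5,
      hpp, sub_zero]
  have hus : star (↑u⁻¹ : U) = ↑u⁻¹ := by
    have h1 : star (↑u⁻¹ : U) * u = 1 := by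
      have := congrArg star u.mul_inv
      rwa [star_mul, hTs.star_eq, star_one] at this
    calc star (↑u⁻¹ : U) = star (↑u⁻¹ : U) * (u * ↑u⁻¹) := by rw [u.mul_inv, mul_one]
      _ = ↑u⁻¹ := by rw [← mul_assoc, h1, one_mul]
  refine ⟨z, p * ↑u⁻¹ * p, hzs, hpz, hzp, ?_, ?_, hzz', ?_, ?_⟩
  · rw [← mul_assoc, ← mul_assoc, hpp]
  · rw [mul_assoc, hpp]
  · have := congrArg star hzz'
    simpa only [star_mul, hps, hus, hzs.star_eq, mul_assoc] using this
  · have h1 : z - x = p * E * p - p * E * q * Di * (q * E * p) := by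
      have h2 : p * u * p = x + p * E * p := by
        rw [hT']
        simp only [mul_add, add_mul, hpx', hxp, hpq, add_zero]
      have h3 : p * u * q = p * E * q := by
        rw [hT']
        simp only [mul_add, add_mul, hpx', hxq, hpq, add_zero, zero_add]
      have hqx : q * x = 0 := by rw [← hpx', ← mul_assoc, hqp0, zero_mul]
      have h4 : q * u * p = q * E * p := by
        rw [hT']
        simp only [mul_add, add_mul, hqx, hqq, hqp0, zero_add]
      rw [hz, hL, h2, h3, mul_assoc (p * E * q * Di) q, mul_assoc (p * E * q * Di), h4]
      abel
    have hp1 := hp.norm_le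
    have hq1 := hqp.norm_le
    have h2 : ‖p * E * q‖ ≤ δ := by
      calc ‖p * E * q‖ ≤ ‖p‖ * ‖E‖ * ‖q‖ := norm_mul₃_le
        _ ≤ 1 * δ * 1 := by gcongr
        _ = δ := by ring
    have h3 : ‖q * E * p‖ ≤ δ := by
      calc ‖q * E * p‖ ≤ ‖q‖ * ‖E‖ * ‖p‖ := norm_mul₃_le
        _ ≤ 1 * δ * 1 := by gcongr
        _ = δ := by ring
    have h4 : ‖p * E * q * Di * (q * E * p)‖ ≤ δ * 2 * δ := by
      calc _ ≤ ‖p * E * q‖ * ‖Di‖ * ‖q * E * p‖ := norm_mul₃_le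
        _ ≤ δ * 2 * δ := by gcongr
    rw [h1]
    have h5 := norm_sub_le (p * E * p) (p * E * q * Di * (q * E * p))
    have h6 := hp.norm_conj_le E
    nlinarith

end Corners

section Order

variable {U : Type*} [CStarAlgebra U] [PartialOrder U] [StarOrderedRing U]

lemma IsSelfAdjoint.le_smul_one {y : U} (hy : IsSelfAdjoint y) {μ : ℝ} (h : ‖y‖ ≤ μ) :
    y ≤ μ • (1 : U) := by
  refine hy.le_algebraMap_norm_self.trans ?_
  rw [Algebra.algebraMap_eq_smul_one]
  exact smul_le_smul_of_nonneg_right h zero_le_one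

lemma IsStarProjection.conj_le_conj {p a b : U} (hp : IsStarProjection p) (h : a ≤ b) :
    p * a * p ≤ p * b * p := by
  simpa [hp.isSelfAdjoint.star_eq] using star_left_conjugate_le_conjugate h p

lemma exists_projection_of_lt_norm
    (hRR : ∀ x : U, IsSelfAdjoint x → ∀ ε : ℝ, 0 < ε →
      ∃ y : U, IsSelfAdjoint y ∧ IsUnit y ∧ ‖x - y‖ < ε)
    {p d : U} (hp : IsStarProjection p) (hd : 0 ≤ d) (hpd : p * d * p = d)
    {c : ℝ} (hc : 0 < c) (hcd : c < ‖d‖) :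
    ∃ r : U, IsStarProjection r ∧ r ≠ 0 ∧ p * r = r ∧ r * p = r ∧ c • r ≤ r * d * r := by
  have hpp : p * p = p := hp.isIdempotentElem
  have hds : IsSelfAdjoint d := .of_nonneg hd
  set c1 := (c + ‖d‖) / 2 with hc1
  set μ := (‖d‖ - c) / 4 with hμ
  have hμ0 : 0 < μ := by rw [hμ]; linarith
  obtain ⟨z, z', hzs, hpz, hzp, hpz', hzp', hzz, hzz', hzn⟩ := exists_invertible_in_corner hRR hp
    (x := d - c1 • p) (hds.sub ((IsSelfAdjoint.all c1).smul hp.isSelfAdjoint))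
    (by rw [mul_sub, sub_mul, hpd, mul_smul_comm, smul_mul_assoc, hpp, hpp]) hμ0
  obtain ⟨q, hq⟩ : ∃ q, q = 1 - p := ⟨_, rfl⟩
  have hqp : IsStarProjection q := hq ▸ hp.one_sub
  have hqq : q * q = q := hqp.isIdempotentElem
  have hpq : p * q = 0 := hq ▸ hp.mul_one_sub_self
  have hqp0 : q * p = 0 := hq ▸ hp.one_sub_mul_self
  have hzq : z * q = 0 := by rw [← hzp, mul_assoc, hpq, mul_zero]
  have hzq' : z' * q = 0 := by rw [← hzp', mul_assoc, hpq, mul_zero]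
  have hqz : q * z = 0 := by rw [← hpz, ← mul_assoc, hqp0, zero_mul]
  have hqz' : q * z' = 0 := by rw [← hpz', ← mul_assoc, hqp0, zero_mul]
  set Z := z - q with hZ
  have hZs : IsSelfAdjoint Z := hzs.sub hqp.isSelfAdjoint
  have hZu : IsUnit Z := by
    refine ⟨⟨Z, z' - q, ?_, ?_⟩, rfl⟩
    · rw [hZ, sub_mul, mul_sub, mul_sub, hzz, hzq, hqz', hqq, hq]; abel
    · rw [hZ, sub_mul, mul_sub, mul_sub, hzz', hzq', hqz, hqq, hq]; abel
  have hne : ∀ t ∈ spectrum ℝ Z, t ≠ 0 := by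
    rintro t ht rfl
    exact spectrum.zero_notMem ℝ hZu ht
  have hcont : ContinuousOn (fun t : ℝ => if 0 < t then (1 : ℝ) else 0) (spectrum ℝ Z) := by
    intro t ht
    refine ContinuousAt.continuousWithinAt ?_
    rcases lt_or_gt_of_ne (hne t ht) with h | h
    · refine (continuousAt_const (y := (0 : ℝ))).congr ?_
      filter_upwards [gt_mem_nhds h] with s hs
      rw [if_neg (not_lt.mpr hs.le)]
    · refine (continuousAt_const (y := (1 : ℝ))).congr ?_
      filter_upwards [lt_mem_nhds h] with s hs
      rw [if_pos hs]
  set r := cfc (fun t : ℝ => if 0 < t then (1 : ℝ) else 0) Z with hr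
  have hrp : IsStarProjection r := by
    refine ⟨?_, cfc_predicate _ Z⟩
    rw [IsIdempotentElem, hr, ← cfc_mul ..]
    exact cfc_congr fun t _ => by simp
  have hrq : r * q = 0 := by
    have h1 : Z * q = (-1 : ℝ) • q := by rw [hZ, sub_mul, hzq, hqq]; simp
    have := cfc_mul_eq_smul hZs (C := 1) hcont zero_le_one (fun s _ => ?_) h1
    · rw [hr, this]; norm_num
    · rw [if_neg (by norm_num : ¬ (0 : ℝ) < -1)]
      split_ifs with h
      · rw [sub_zero, abs_one, one_mul, abs_of_pos (by linarith)]; linarith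
      · simp
  have hrp' : r * p = r := by
    have : r * (p + q) = r := by rw [hq]; simp
    rwa [mul_add, hrq, add_zero] at this
  have hpr' : p * r = r := by
    have := congrArg star hrp'
    rwa [star_mul, hrp.isSelfAdjoint.star_eq, hp.isSelfAdjoint.star_eq] at this
  have hrZr : r * Z * r = cfc (fun t : ℝ => (if 0 < t then (1 : ℝ) else 0) * t *
      (if 0 < t then (1 : ℝ) else 0)) Z := by
    rw [cfc_mul .., cfc_mul .., cfc_id' ℝ Z]
  have hrzr : r * Z * r = r * z * r := by
    rw [hZ, mul_sub, hrq, sub_zero]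
  have hnn : 0 ≤ r * z * r := by
    rw [← hrzr, hrZr]
    refine cfc_nonneg fun t _ => ?_
    split_ifs with h <;> simp [le_of_lt, h]
  have hle : d - z - c1 • p ≤ μ • 1 := by
    refine IsSelfAdjoint.le_smul_one ?_ ?_
    · exact (hds.sub hzs).sub ((IsSelfAdjoint.all c1).smul hp.isSelfAdjoint)
    · rw [← norm_neg, show -(d - z - c1 • p) = z - (d - c1 • p) by abel]; exact hzn.le
  refine ⟨r, hrp, ?_, hpr', hrp', ?_⟩
  · intro hr0
    have hZ0 : Z ≤ 0 := by
      have : Z ≤ r * Z * r := by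
        rw [hrZr]
        conv_lhs => rw [← cfc_id' ℝ Z]
        refine cfc_mono fun t _ => ?_
        split_ifs with h
        · simp
        · simpa using h
      simpa [hr0] using this
    have hz0 : z ≤ 0 := by
      have := hp.conj_le_conj hZ0
      rw [hZ, mul_sub, sub_mul, hpz, hzp, hpq] at this
      simpa using this
    have h1 : d ≤ (‖d‖ - (‖d‖ - c) / 4) • (1 : U) := by
      have h2 : c1 • p ≤ c1 • (1 : U) := smul_le_smul_of_nonneg_left hp.le_one (by linarith)
      have h3 := add_le_add (add_le_add hle hz0) h2
      rwa [add_zero, ← add_smul, show d - z - c1 • p + z + c1 • p = d by abel,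
        show μ + c1 = ‖d‖ - (‖d‖ - c) / 4 by rw [hμ, hc1]; ring] at h3
    have h2 : ‖d‖ ≤ ‖d‖ - (‖d‖ - c) / 4 := by
      rw [CStarAlgebra.norm_le_iff_le_algebraMap d (by linarith) hd,
        Algebra.algebraMap_eq_smul_one]
      exact h1
    linarith
  · have hle2 : -(d - z - c1 • p) ≤ μ • 1 := by
      refine IsSelfAdjoint.le_smul_one ?_ ?_
      · exact ((hds.sub hzs).sub ((IsSelfAdjoint.all c1).smul hp.isSelfAdjoint)).neg
      · rw [show -(d - z - c1 • p) = z - (d - c1 • p) by abel]; exact hzn.le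
    have h1 := hrp.conj_le_conj hle2
    have hrr : r * r = r := hrp.isIdempotentElem
    have h2 : r * -(d - z - c1 • p) * r = r * z * r + c1 • r - r * d * r := by
      simp only [mul_neg, neg_mul, mul_sub, sub_mul, mul_smul_comm, smul_mul_assoc, hrp', hrr]
      abel
    have h3 : r * (μ • (1 : U)) * r = μ • r := by
      simp only [mul_smul_comm, smul_mul_assoc, mul_one, hrr]
    rw [h2, h3] at h1
    have h4 : c • r ≤ c1 • r - μ • r := by
      rw [← sub_smul]
      exact smul_le_smul_of_nonneg_right (by rw [hc1, hμ]; linarith) hrp.nonneg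
    refine h4.trans ?_
    have h5 : c1 • r - r * d * r ≤ r * z * r + c1 • r - r * d * r := by
      rw [add_sub_assoc]
      exact le_add_of_nonneg_left hnn
    have h6 := h5.trans h1
    rw [sub_le_iff_le_add] at h6 ⊢
    rwa [add_comm]

end Order

section Perturbation

variable {U : Type*} [CStarAlgebra U] [PartialOrder U] [StarOrderedRing U]

/-- The continuous cut-off equal to `1` on `(-∞, η]` and to `0` on `[2 η, ∞)`. -/
noncomputable def lowerCutoff (η t : ℝ) : ℝ := max 0 (min 1 ((2 * η - t) / η))

lemma continuous_lowerCutoff (η : ℝ) : Continuous (lowerCutoff η) := by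
  unfold lowerCutoff; fun_prop

lemma lowerCutoff_nonneg (η t : ℝ) : 0 ≤ lowerCutoff η t := le_max_left _ _

lemma lowerCutoff_le_one (η t : ℝ) : lowerCutoff η t ≤ 1 :=
  max_le zero_le_one (min_le_left _ _)

lemma lowerCutoff_of_le {η t : ℝ} (hη : 0 < η) (h : t ≤ η) : lowerCutoff η t = 1 := by
  have : 1 ≤ (2 * η - t) / η := by rw [le_div_iff₀ hη]; linarith
  simp [lowerCutoff, this]

lemma lowerCutoff_of_ge {η t : ℝ} (hη : 0 < η) (h : 2 * η ≤ t) : lowerCutoff η t = 0 := by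
  have : (2 * η - t) / η ≤ 0 := div_nonpos_of_nonpos_of_nonneg (by linarith) hη.le
  rw [lowerCutoff, max_eq_left]
  exact (min_le_right _ _).trans this

lemma lowerCutoff_le_div {η l t : ℝ} (hη : 0 < η) (h : 2 * η ≤ l) :
    lowerCutoff η t ≤ η⁻¹ * |t - l| := by
  refine max_le (by positivity) ((min_le_right _ _).trans ?_)
  rw [div_eq_inv_mul]
  refine mul_le_mul_of_nonneg_left ?_ (by positivity)
  rw [abs_sub_comm]
  exact (by linarith : 2 * η - t ≤ l - t).trans (le_abs_self _)

lemma cfc_lowerCutoff_mul_eq_zero {c q : U} (hc : IsSelfAdjoint c) {η l : ℝ} (hη : 0 < η)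
    (hl : 2 * η ≤ l) (hq : c * q = l • q) : cfc (lowerCutoff η) c * q = 0 := by
  rw [cfc_mul_eq_smul hc (C := η⁻¹) (continuous_lowerCutoff η).continuousOn (by positivity)
    (fun t _ => ?_) hq, lowerCutoff_of_ge hη hl, zero_smul]
  rw [lowerCutoff_of_ge hη hl, sub_zero, abs_of_nonneg (lowerCutoff_nonneg _ _)]
  exact lowerCutoff_le_div hη hl

/-- A self-adjoint element whose small and negative spectral part is Cuntz-dominated by an
eigenprojection becomes invertible after removing that eigenprojection and perturbing. -/
lemma exists_unit_near_sub_smul {c r v : U} (hc : IsSelfAdjoint c) (hr : IsStarProjection r)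
    {η l : ℝ} (hη : 0 < η) (hl : 2 * η ≤ l) (hcr : c * r = l • r) (hvr : v * r = v)
    (hrv : r * v = 0) (hv1 : ‖v‖ ≤ 1)
    (hvv : ‖v * star v - cfc (lowerCutoff η) c * cfc (lowerCutoff η) c‖ ≤ 1 / 18) :
    ∃ M : U, IsSelfAdjoint M ∧ IsUnit M ∧ ‖M - (c - l • r)‖ ≤ 5 * η ∧
      (∀ e, c * e = l • e → r * e = 0 → M * e = l • e) ∧
      ∀ β : U →⋆ₐ[ℂ] U, β c = c → β r = r → β v = v → β M = M := by
  set g := cfc (lowerCutoff η) c with hg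
  obtain ⟨S, hS⟩ : ∃ S : ℝ → ℝ, S = fun t => √(max (η ^ 2 - t ^ 2) 0) := ⟨_, rfl⟩
  obtain ⟨K, hK⟩ : ∃ K : ℝ → ℝ, K = fun t => η - max (-η) (min η t) := ⟨_, rfl⟩
  have hSc : Continuous S := by rw [hS]; fun_prop
  have hKc : Continuous K := by rw [hK]; fun_prop
  have hGc := continuous_lowerCutoff η
  have hS0 : ∀ t, η ≤ |t| → S t = 0 := by
    intro t ht
    have : η ^ 2 - t ^ 2 ≤ 0 := by nlinarith [sq_abs t]
    simp [hS, max_eq_right this]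
  have hS1 : ∀ t, |t| ≤ η → S t ^ 2 = η ^ 2 - t ^ 2 := by
    intro t ht
    have : 0 ≤ η ^ 2 - t ^ 2 := by nlinarith [sq_abs t, abs_nonneg t]
    simp only [hS, max_eq_left this]
    exact Real.sq_sqrt this
  have hSnn : ∀ t, 0 ≤ S t := fun t => by rw [hS]; exact Real.sqrt_nonneg _
  have hSle : ∀ t, S t ≤ η := by
    intro t
    rcases le_total η |t| with h | h
    · rw [hS0 t h]; exact hη.le
    · have := hS1 t h
      nlinarith [hSnn t]
  have hK0 : ∀ t, η ≤ t → K t = 0 := by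
    intro t ht
    simp only [hK]
    rw [min_eq_left ht, max_eq_right (by linarith), sub_self]
  have hK1 : ∀ t, |t| ≤ η → K t = η - t := by
    intro t ht
    rw [abs_le] at ht
    simp only [hK]
    rw [min_eq_right ht.2, max_eq_right ht.1]
  have hK2 : ∀ t, t ≤ -η → K t = 2 * η := by
    intro t ht
    simp only [hK]
    rw [min_eq_right (by linarith), max_eq_left ht]
    ring
  have tri : ∀ t : ℝ, t ≤ -η ∨ |t| ≤ η ∨ η ≤ t := by
    intro t
    rcases le_total t (-η) with h | h
    · exact .inl h
    · rcases le_total t η with h' | h'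
      · exact .inr (.inl (abs_le.mpr ⟨h, h'⟩))
      · exact .inr (.inr h')
  have hKb : ∀ t, 0 ≤ K t ∧ K t ≤ 2 * η ∧ K t ≤ |t - l| := by
    intro t
    have := le_abs_self (l - t)
    rw [abs_sub_comm] at this
    rcases tri t with h | h | h
    · rw [hK2 t h]; exact ⟨by linarith, le_rfl, by linarith⟩
    · rw [hK1 t h]
      have := abs_le.mp h
      exact ⟨by linarith, by linarith, by linarith⟩
    · rw [hK0 t h]; exact ⟨le_rfl, by linarith, abs_nonneg _⟩
  set s := cfc S c with hs
  set k := cfc K c with hk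
  have hsK : ∀ e, c * e = l • e → s * e = 0 := by
    intro e he
    have hSl : S l = 0 := hS0 l ((by linarith : η ≤ l).trans (le_abs_self l))
    rw [hs, cfc_mul_eq_smul hc (C := 1) hSc.continuousOn zero_le_one (fun t _ => ?_) he, hSl,
      zero_smul]
    rw [hSl, sub_zero, abs_of_nonneg (hSnn t), one_mul]
    rcases le_total η |t| with h | h
    · rw [hS0 t h]; exact abs_nonneg _
    · have := le_abs_self (l - t)
      rw [abs_sub_comm] at this
      have := abs_le.mp h
      linarith [hSle t]
  have hkK : ∀ e, c * e = l • e → k * e = 0 := by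
    intro e he
    have hKl : K l = 0 := hK0 l (by linarith)
    rw [hk, cfc_mul_eq_smul hc (C := 1) hKc.continuousOn zero_le_one (fun t _ => ?_) he, hKl,
      zero_smul]
    rw [hKl, sub_zero, abs_of_nonneg (hKb t).1, one_mul]
    exact (hKb t).2.2
  have hss : IsSelfAdjoint s := cfc_predicate _ c
  have hks : IsSelfAdjoint k := cfc_predicate _ c
  have hrs : star r = r := hr.isSelfAdjoint
  have hrr : r * r = r := hr.isIdempotentElem
  have hsr : s * r = 0 := hsK r hcr
  have hkr : k * r = 0 := hkK r hcr
  have hrs' : r * s = 0 := by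
    have := congrArg star hsr
    rwa [star_mul, hrs, hss.star_eq, star_zero] at this
  have hrc : r * c = l • r := by
    have := congrArg star hcr
    rwa [star_mul, hrs, hc.star_eq, star_smul, hrs, star_trivial] at this
  have hsn : ‖s‖ ≤ η := norm_cfc_le hη.le fun t _ => by
    rw [Real.norm_eq_abs, abs_of_nonneg (hSnn t)]; exact hSle t
  have hkn : ‖k‖ ≤ 2 * η := norm_cfc_le (by linarith) fun t _ => by
    rw [Real.norm_eq_abs, abs_of_nonneg (hKb t).1]; exact (hKb t).2.1
  have hsg : s * (g * g) = s := by
    rw [hs, hg, ← cfc_mul .., ← cfc_mul ..]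
    refine cfc_congr fun t _ => ?_
    rcases tri t with h | h | h
    · simp [lowerCutoff_of_le hη (by linarith : t ≤ η)]
    · simp [lowerCutoff_of_le hη (le_of_abs_le h)]
    · simp [hS0 t (h.trans (le_abs_self t))]
  have hkg : k * (g * g) = k := by
    rw [hk, hg, ← cfc_mul .., ← cfc_mul ..]
    refine cfc_congr fun t _ => ?_
    rcases tri t with h | h | h
    · simp [lowerCutoff_of_le hη (by linarith : t ≤ η)]
    · simp [lowerCutoff_of_le hη (le_of_abs_le h)]
    · simp [hK0 t h]
  have hsk : s * k = η • s - c * s := by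
    rw [hs, hk, ← cfc_mul .., ← cfc_smul ..]
    nth_rewrite 3 [← cfc_id' ℝ c]
    rw [← cfc_mul .., ← cfc_sub ..]
    refine cfc_congr fun t _ => ?_
    simp only [smul_eq_mul]
    rcases le_total η |t| with h | h
    · simp [hS0 t h]
    · rw [hK1 t h]; ring
  have hskk : s * s - (2 * η) • k + k * k = 0 := by
    rw [hs, hk, ← cfc_mul .., ← cfc_mul .., ← cfc_smul .., ← cfc_sub .., ← cfc_add ..,
      ← cfc_const_zero ℝ c]
    refine cfc_congr fun t _ => ?_
    simp only [smul_eq_mul, ← sq]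
    rcases tri t with h | h | h
    · rw [hS0 t (by rw [le_abs]; right; linarith), hK2 t h]; ring
    · rw [hS1 t h, hK1 t h]; ring
    · rw [hS0 t (h.trans (le_abs_self t)), hK0 t h]; ring
  have hm : (η ^ 2) • (1 : U) ≤ c * c + s * s := by
    have h1 : c * c + s * s = cfc (fun t => t * t + S t * S t) c := by
      rw [cfc_add .., cfc_mul .., cfc_mul .., cfc_id' ℝ c]
    rw [h1, ← Algebra.algebraMap_eq_smul_one, ← cfc_const (η ^ 2) c hc]
    refine cfc_mono fun t _ => ?_
    rcases le_total η |t| with h | h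
    · rw [hS0 t h]; nlinarith [sq_abs t]
    · have := hS1 t h
      nlinarith
  set D := v * star v - g * g with hD
  have hvvD : v * star v = D + g * g := by rw [hD]; abel
  have hrsv : r * star v = star v := by
    have := congrArg star hvr
    rwa [star_mul, hrs] at this
  have hsvr : star v * r = 0 := by
    have := congrArg star hrv
    rwa [star_mul, hrs, star_zero] at this
  set a := c - l • r with ha
  have has : IsSelfAdjoint a := hc.sub ((IsSelfAdjoint.all l).smul hr.isSelfAdjoint)
  have har : a * r = 0 := by rw [ha, sub_mul, hcr, smul_mul_assoc, hrr, sub_self]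
  have hra : r * a = 0 := by rw [ha, mul_sub, hrc, mul_smul_comm, hrr, sub_self]
  set w := s * v with hw
  set b := star v * k * v - η • r with hb
  have hbs : IsSelfAdjoint b := by
    refine IsSelfAdjoint.sub ?_ ((IsSelfAdjoint.all η).smul hr.isSelfAdjoint)
    rw [isSelfAdjoint_iff]
    simp only [star_mul, star_star, hks.star_eq, mul_assoc]
  have hsw : star w = star v * s := by rw [hw, star_mul, hss.star_eq]
  have hbr : r * b = b := by
    rw [hb, mul_sub, mul_smul_comm, hrr, ← mul_assoc, ← mul_assoc, hrsv]
  have hwr : w * r = w := by rw [hw, mul_assoc, hvr]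
  have hrw : r * w = 0 := by rw [hw, ← mul_assoc, hrs', zero_mul]
  have hbr' : b * r = b := by
    have := congrArg star hbr
    rwa [star_mul, hbs.star_eq, hrs] at this
  have hwr' : r * star w = star w := by
    have := congrArg star hwr
    rwa [star_mul, hrs] at this
  have hrw' : star w * r = 0 := by
    have := congrArg star hrw
    rwa [star_mul, hrs, star_zero] at this
  set M := a + w + star w + b with hM
  have hMs : IsSelfAdjoint M := by
    rw [isSelfAdjoint_iff, hM]
    simp only [star_add, star_star, has.star_eq, hbs.star_eq]
    abel
  have e1 : a * star w = 0 := by rw [← hwr', ← mul_assoc, har, zero_mul]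
  have e2 : a * b = 0 := by rw [← hbr, ← mul_assoc, har, zero_mul]
  have e3 : w * a = 0 := by rw [← hwr, mul_assoc, hra, mul_zero]
  have e4 : w * w = 0 := by
    nth_rewrite 1 [← hwr]
    rw [mul_assoc, hrw, mul_zero]
  have e5 : star w * star w = 0 := by rw [← star_mul, e4, star_zero]
  have e6 : star w * b = 0 := by rw [← hbr, ← mul_assoc, hrw', zero_mul]
  have e7 : b * a = 0 := by rw [← hbr', mul_assoc, hra, mul_zero]
  have e8 : b * w = 0 := by rw [← hbr', mul_assoc, hrw, mul_zero]
  have haa : a * a = c * c - (l ^ 2) • r := by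
    have h1 : a * a = a * c := by
      nth_rewrite 2 [ha]
      rw [mul_sub, mul_smul_comm, har, smul_zero, sub_zero]
    rw [h1, ha, sub_mul, smul_mul_assoc, hrc, smul_smul, sq]
  have hww : w * star w = s * s + s * D * s := by
    calc w * star w = s * (v * star v) * s := by rw [hsw, hw]; simp only [mul_assoc]
      _ = s * D * s + s * (g * g) * s := by rw [hvvD, mul_add, add_mul]
      _ = s * s + s * D * s := by rw [hsg, add_comm]
  have has' : a * s = c * s := by rw [ha, sub_mul, smul_mul_assoc, hrs', smul_zero, sub_zero]
  have hkgg : g * g * k = k := by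
    have := congrArg star hkg
    have hgs : star g = g := (cfc_predicate (lowerCutoff η) c : IsSelfAdjoint g)
    rwa [star_mul, star_mul, hks.star_eq, hgs] at this
  have hX : a * w + w * b = s * D * k * v := by
    calc a * w + w * b = a * s * v + (s * (v * star v) * k * v - η • (s * v * r)) := by
          rw [hw, hb, mul_sub, mul_smul_comm]; simp only [mul_assoc]
      _ = c * s * v + (s * D * k * v + s * (g * g * k) * v - η • (s * v)) := by
          rw [has', hvvD, mul_assoc s v r, hvr]
          simp only [mul_add, add_mul, mul_assoc]
      _ = s * D * k * v := by
          rw [hkgg, hsk, sub_mul, smul_mul_assoc]; abel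
  have hY : star w * a + b * star w = star (s * D * k * v) := by
    rw [← hX, star_add, star_mul a w, star_mul w b, has.star_eq, hbs.star_eq]
  have hZ : star w * w + b * b = (η ^ 2) • r + star v * k * D * k * v := by
    have h1 : b * b = star v * k * (v * star v) * k * v - (2 * η) • (star v * k * v)
        + (η ^ 2) • r := by
      rw [hb]
      have h2 : star v * k * v * r = star v * k * v := by rw [mul_assoc, hvr]
      have h3 : r * (star v * k * v) = star v * k * v := by
        rw [← mul_assoc, ← mul_assoc, hrsv]
      simp only [mul_sub, sub_mul, mul_smul_comm, smul_mul_assoc, h2, h3, hrr]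
      rw [show star v * k * v * (star v * k * v) = star v * k * (v * star v) * k * v by
        simp only [mul_assoc]]
      module
    have h2 : star w * w = star v * (s * s) * v := by rw [hsw, hw]; simp only [mul_assoc]
    have h3 : star v * k * (v * star v) * k * v
        = star v * k * D * k * v + star v * (k * k) * v := by
      rw [hvvD]
      calc _ = star v * k * D * k * v + star v * (k * (g * g)) * k * v := by
            simp only [mul_add, add_mul, mul_assoc]
        _ = _ := by rw [hkg]; simp only [mul_assoc]
    have h4 : star v * (s * s) * v - (2 * η) • (star v * k * v) + star v * (k * k) * v = 0 := by
      have := congrArg (fun x => star v * x * v) hskk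
      simpa only [mul_add, mul_sub, add_mul, sub_mul, mul_smul_comm, smul_mul_assoc, mul_zero,
        zero_mul] using this
    rw [h1, h2, h3]
    calc _ = (star v * (s * s) * v - (2 * η) • (star v * k * v) + star v * (k * k) * v)
          + ((η ^ 2) • r + star v * k * D * k * v) := by abel
      _ = _ := by rw [h4, zero_add]
  set E := s * D * s + s * D * k * v + star (s * D * k * v) + star v * k * D * k * v with hE
  have hMM : M * M = (c * c + s * s - (l ^ 2) • r + (η ^ 2) • r) + E := by
    have h1 : M * M = a * a + (a * w + w * b) + (star w * a + b * star w) + w * star w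
        + (star w * w + b * b) := by
      rw [hM]
      simp only [mul_add, add_mul, e1, e2, e3, e4, e5, e6, e7, e8]
      abel
    rw [h1, hX, hY, hZ, haa, hww, hE]
    abel
  have hEs : IsSelfAdjoint E := by
    have h1 : E = M * M - (c * c + s * s - (l ^ 2) • r + (η ^ 2) • r) := by rw [hMM]; abel
    have h2 : ∀ x : U, IsSelfAdjoint x → IsSelfAdjoint (x * x) := fun x hx => by
      simpa [hx.star_eq] using IsSelfAdjoint.star_mul_self x
    rw [h1]
    exact (h2 M hMs).sub ((((h2 c hc).add (h2 s hss)).sub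
      ((IsSelfAdjoint.all _).smul hr.isSelfAdjoint)).add
      ((IsSelfAdjoint.all _).smul hr.isSelfAdjoint))
  have hEn : ‖E‖ ≤ η ^ 2 / 2 := by
    have hsv : ‖star v‖ ≤ 1 := by rwa [norm_star]
    have hn : ∀ x y z : U, ‖x * y * z‖ ≤ ‖x‖ * ‖y‖ * ‖z‖ := fun x y z => norm_mul₃_le
    have h1 : ‖s * D * s‖ ≤ η * (1 / 18) * η := by
      refine (hn _ _ _).trans ?_
      gcongr
    have h2 : ‖s * D * k * v‖ ≤ η * (1 / 18) * (2 * η) * 1 := by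
      refine (norm_mul_le _ _).trans (mul_le_mul ((hn _ _ _).trans ?_) hv1 (norm_nonneg _)
        (by positivity))
      gcongr
    have h3 : ‖star v * k * D * k * v‖ ≤ 1 * (2 * η) * (1 / 18) * (2 * η) * 1 := by
      refine (norm_mul_le _ _).trans (mul_le_mul ((norm_mul_le _ _).trans (mul_le_mul
        ((hn _ _ _).trans ?_) hkn (norm_nonneg _) (by positivity))) hv1 (norm_nonneg _)
        (by positivity))
      gcongr
    have h4 := norm_star (s * D * k * v)
    have h5 := norm_add₃_le (a := s * D * s) (b := s * D * k * v) (c := star (s * D * k * v))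
    have h6 := norm_add_le (s * D * s + s * D * k * v + star (s * D * k * v))
      (star v * k * D * k * v)
    rw [hE]
    nlinarith
  have hmain : (η ^ 2) • (1 : U) ≤ c * c + s * s - (l ^ 2) • r + (η ^ 2) • r := by
    have h1 := hr.one_sub.conj_le_conj hm
    have h2 : (1 - r) * ((η ^ 2) • (1 : U)) * (1 - r) = (η ^ 2) • (1 : U) - (η ^ 2) • r := by
      rw [mul_smul_comm, mul_one, smul_mul_assoc, hr.one_sub.isIdempotentElem, smul_sub]
    have h3 : (1 - r) * (c * c + s * s) * (1 - r) = c * c + s * s - (l ^ 2) • r := by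
      have h4 : (c * c + s * s) * r = (l ^ 2) • r := by
        rw [add_mul, mul_assoc, mul_assoc, hcr, hsr, mul_zero, add_zero, mul_smul_comm, hcr,
          smul_smul, sq]
      have h5 : r * (c * c + s * s) = (l ^ 2) • r := by
        rw [mul_add, ← mul_assoc, ← mul_assoc, hrc, hrs', zero_mul, add_zero, smul_mul_assoc, hrc,
          smul_smul, sq]
      rw [sub_mul, one_mul, h5, sub_mul, mul_sub, mul_sub, mul_one, mul_one, h4, smul_mul_assoc,
        hrr, sub_self, sub_zero]
    rw [h2, h3] at h1
    have := add_le_add_left h1 ((η ^ 2) • r)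
    simpa using this
  have hge : (η ^ 2 / 2) • (1 : U) ≤ M * M := by
    have h1 := hEs.neg.le_smul_one (by rwa [norm_neg] : ‖-E‖ ≤ η ^ 2 / 2)
    have h2 : (η ^ 2 / 2) • (1 : U) = (η ^ 2) • (1 : U) - (η ^ 2 / 2) • (1 : U) := by
      rw [← sub_smul]; congr 1; ring
    rw [hMM, h2, sub_le_iff_le_add]
    refine hmain.trans ?_
    rw [add_assoc]
    refine le_add_of_nonneg_right ?_
    have := add_le_add_right h1 E
    simpa using this
  refine ⟨M, hMs, ?_, ?_, ?_, ?_⟩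
  · have h1 : IsUnit (M * M) := by
      refine CStarAlgebra.isUnit_of_le ((η ^ 2 / 2) • (1 : U)) hge ?_
      refine IsStrictlyPositive.smul ?_ ?_
      · positivity
      · exact isStrictlyPositive_one
    rw [← sq] at h1
    exact (isUnit_pow_iff two_ne_zero).mp h1
  · have h1 : M - a = w + star w + star v * k * v - η • r := by rw [hM, hb]; abel
    have hsv : ‖star v‖ ≤ 1 := by rwa [norm_star]
    have h2 : ‖w‖ ≤ η * 1 := (norm_mul_le _ _).trans (by gcongr)
    have h3 : ‖star v * k * v‖ ≤ 1 * (2 * η) * 1 := norm_mul₃_le.trans (by gcongr)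
    have h4 : ‖η • r‖ ≤ η * 1 := by
      rw [norm_smul, Real.norm_eq_abs, abs_of_pos hη]
      have := hr.norm_le
      gcongr
    rw [h1]
    have h5 := norm_sub_le (w + star w + star v * k * v) (η • r)
    have h6 := norm_add₃_le (a := w) (b := star w) (c := star v * k * v)
    rw [norm_star] at h6
    linarith
  · intro e he hre
    have hve : v * e = 0 := by rw [← hvr, mul_assoc, hre, mul_zero]
    rw [hM, hsw, hw, hb, ha]
    simp only [add_mul, sub_mul, mul_assoc, hve, hsK e he, smul_mul_assoc, hre, he, mul_zero,
      smul_zero]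
    simp
  · intro β hβc hβr hβv
    have hβs : β s = s := by
      rw [hs, StarAlgHomClass.map_cfc β S c (hφa := hβc.symm ▸ hc), hβc]
    have hβk : β k = k := by
      rw [hk, StarAlgHomClass.map_cfc β K c (hφa := hβc.symm ▸ hc), hβc]
    rw [hM, hsw, hw, hb, ha]
    simp only [map_add, map_sub, map_mul, map_star, hβs, hβk, hβv, hβc]
    have hsm : ∀ x : ℝ, β (x • r) = x • r := fun x => by
      rw [← Complex.coe_smul, map_smul, hβr]
    rw [hsm, hsm]

end Perturbation

section CuntzComparison

variable {U : Type*} [CStarAlgebra U] [PartialOrder U] [StarOrderedRing U]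

/-- An approximate polar decomposition: if `κ g² ≤ K K*`, then `g² ≈ v v*` for some `v ∈ g U K`. -/
lemma exists_mul_star_near_of_smul_le {g K : U} (hg : IsSelfAdjoint g) {κ ε : ℝ} (hκ : 0 < κ)
    (h : κ • (g * g) ≤ K * star K) (hε : 0 < ε) :
    ∃ R : U, g * R * K * star (g * R * K) ≤ g * g ∧
      ‖g * R * K * star (g * R * K) - g * g‖ ≤ ε := by
  set b := K * star K with hb
  have hb0 : 0 ≤ b := mul_star_self_nonneg K
  have hbs : IsSelfAdjoint b := .of_nonneg hb0
  set e := κ * ε with he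
  have he0 : 0 < e := mul_pos hκ hε
  obtain ⟨f, hf⟩ : ∃ f : ℝ → ℝ, f = fun t => (√(max t 0 + e))⁻¹ := ⟨_, rfl⟩
  have hpos : ∀ t : ℝ, 0 < max t 0 + e := fun t => by positivity
  have hfc : Continuous f := by
    rw [hf]
    exact Continuous.inv₀ (by fun_prop) fun t => (Real.sqrt_pos.mpr (hpos t)).ne'
  have hff : ∀ t, f t * f t * (max t 0 + e) = 1 := by
    intro t
    have h1 := Real.mul_self_sqrt (hpos t).le
    have h2 := (Real.sqrt_pos.mpr (hpos t)).ne'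
    simp only [hf]
    nth_rewrite 3 [← h1]
    field_simp
  set R := cfc f b with hR
  have hRs : IsSelfAdjoint R := cfc_predicate _ b
  have hRbR : R * b * R = 1 - e • (R * R) := by
    have h1 : R * b * R = cfc (fun t => f t * t * f t) b := by
      rw [cfc_mul .., cfc_mul .., cfc_id' ℝ b]
    rw [h1, hR, ← cfc_mul .., ← cfc_smul .., ← cfc_one ℝ b, ← cfc_sub ..]
    refine cfc_congr fun t ht => ?_
    have h2 := hff t
    rw [max_eq_left (spectrum_nonneg_of_nonneg hb0 ht)] at h2
    simp only [smul_eq_mul, Pi.one_apply]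
    linarith
  have hRR0 : 0 ≤ R * R := by simpa [hRs.star_eq] using star_mul_self_nonneg R
  have hv : g * R * K * star (g * R * K) = g * g - e • (g * (R * R) * g) := by
    calc _ = g * (R * b * R) * g := by
          rw [star_mul, star_mul, hg.star_eq, hRs.star_eq, hb]; simp only [mul_assoc]
      _ = _ := by rw [hRbR, mul_sub, sub_mul, mul_one, mul_smul_comm, smul_mul_assoc]
  have hgRR : 0 ≤ g * (R * R) * g := by
    simpa [hg.star_eq] using star_left_conjugate_nonneg hRR0 g
  refine ⟨R, ?_, ?_⟩
  · rw [hv]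
    exact sub_le_self _ (smul_nonneg he0.le hgRR)
  · have h1 : κ • (R * (g * g) * R) ≤ 1 := by
      have h2 := star_left_conjugate_le_conjugate h R
      rw [hRs.star_eq, hRbR, mul_smul_comm, smul_mul_assoc] at h2
      exact h2.trans (sub_le_self _ (smul_nonneg he0.le hRR0))
    have h3 : ‖R * (g * g) * R‖ = ‖g * (R * R) * g‖ := by
      have h4 := CStarRing.norm_star_mul_self (x := g * R)
      have h5 := CStarRing.norm_self_mul_star (x := g * R)
      rw [star_mul, hg.star_eq, hRs.star_eq] at h4 h5
      rw [show R * (g * g) * R = R * g * (g * R) by simp only [mul_assoc],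
        show g * (R * R) * g = g * R * (R * g) by simp only [mul_assoc], h4, h5]
    have h6 : κ * ‖g * (R * R) * g‖ ≤ 1 := by
      have h7 : 0 ≤ R * (g * g) * R := by
        have : 0 ≤ g * g := by simpa [hg.star_eq] using star_mul_self_nonneg g
        simpa [hRs.star_eq] using star_left_conjugate_nonneg this R
      have h8 := CStarAlgebra.norm_le_norm_of_nonneg_of_le (smul_nonneg hκ.le h7) h1
      rw [norm_smul, Real.norm_eq_abs, abs_of_pos hκ, h3] at h8
      exact h8.trans (IsStarProjection.norm_le 1 (.one U))
    rw [hv, sub_sub_cancel_left, norm_neg, norm_smul, Real.norm_eq_abs, abs_of_pos he0, he]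
    nlinarith

lemma exists_dominating_lowerCutoff {c q θ u : U} (hc : IsSelfAdjoint c) (hq : IsStarProjection q)
    {η l ε : ℝ} (hη : 0 < η) (hl : 8 * η ≤ l)
    (hθ : star θ * θ ≤ u * q * star u + (l / 4) • (1 : U))
    (hcθ : l • (1 : U) - θ * star θ ≤ c) (hε : 0 < ε) :
    ∃ v : U, v * q = v ∧ ‖v‖ ≤ 1 ∧
      ‖v * star v - cfc (lowerCutoff η) c * cfc (lowerCutoff η) c‖ ≤ ε ∧
      ∀ e : U, e * cfc (lowerCutoff η) c = 0 → e * v = 0 := by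
  have hGc := continuous_lowerCutoff η
  set g := cfc (lowerCutoff η) c with hg
  have hgs : IsSelfAdjoint g := cfc_predicate _ c
  have hl0 : 0 < l := by linarith
  have hqq : q * q = q := hq.isIdempotentElem
  have hqs : star q = q := hq.isSelfAdjoint
  have hg1 : ‖g‖ ≤ 1 := norm_cfc_le zero_le_one fun t _ => by
    rw [Real.norm_eq_abs, abs_of_nonneg (lowerCutoff_nonneg _ _)]; exact lowerCutoff_le_one _ _
  have hgg0 : 0 ≤ g * g := by simpa [hgs.star_eq] using star_mul_self_nonneg g
  have hconj : ∀ {x y : U}, x ≤ y → g * x * g ≤ g * y * g := fun {x y} h => by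
    simpa [hgs.star_eq] using star_left_conjugate_le_conjugate h g
  have hgcg : g * c * g ≤ (2 * η) • (g * g) := by
    have h1 : g * c * g = cfc (fun t => lowerCutoff η t * t * lowerCutoff η t) c := by
      rw [cfc_mul .., cfc_mul .., cfc_id' ℝ c]
    rw [h1, hg, ← cfc_mul .., ← cfc_smul ..]
    refine cfc_mono fun t _ => ?_
    simp only [smul_eq_mul]
    rcases le_total (2 * η) t with h | h
    · rw [lowerCutoff_of_ge hη h]; simp
    · nlinarith [mul_nonneg (lowerCutoff_nonneg η t) (lowerCutoff_nonneg η t)]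
  set T := θ * star θ with hT
  have hTs : IsSelfAdjoint T := IsSelfAdjoint.mul_star_self θ
  have h1 : (l - 2 * η) • (g * g) ≤ g * T * g := by
    have h2 := (hconj hcθ).trans hgcg
    rw [mul_sub, sub_mul, mul_smul_comm, smul_mul_assoc, mul_one, sub_le_iff_le_add] at h2
    rw [sub_smul, sub_le_iff_le_add, add_comm]
    exact h2
  have h2 : l • T - (l ^ 2 / 4) • (1 : U) ≤ T * T := by
    have hs : IsSelfAdjoint (T - (l / 2) • (1 : U)) :=
      hTs.sub ((IsSelfAdjoint.all _).smul (.one U))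
    have h3 := star_mul_self_nonneg (T - (l / 2) • (1 : U))
    rw [hs.star_eq] at h3
    have h4 : (T - (l / 2) • (1 : U)) * (T - (l / 2) • (1 : U))
        = T * T - (l • T - (l ^ 2 / 4) • (1 : U)) := by
      simp only [mul_sub, sub_mul, mul_smul_comm, smul_mul_assoc, mul_one, one_mul]
      module
    rw [h4] at h3
    exact sub_nonneg.mp h3
  set K := g * θ * u * q with hK
  have hKK : K * star K = g * θ * (u * q * star u) * star θ * g := by
    rw [hK]
    simp only [star_mul, hgs.star_eq, hqs, mul_assoc]
    rw [← mul_assoc q q, hqq]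
  have h3 : g * (T * T) * g - (l / 4) • (g * T * g) ≤ K * star K := by
    have h4 := star_right_conjugate_le_conjugate hθ (g * θ)
    rw [star_mul, hgs.star_eq] at h4
    rw [sub_le_iff_le_add]
    convert h4 using 1
    · rw [hT]; simp only [mul_assoc]
    · rw [hKK, hT, mul_add, add_mul, mul_smul_comm, smul_mul_assoc, mul_one]
      simp only [mul_assoc]
  have h4 : l • (g * T * g) - (l ^ 2 / 4) • (g * g) ≤ g * (T * T) * g := by
    have := hconj h2
    simpa only [mul_sub, sub_mul, mul_smul_comm, smul_mul_assoc, mul_one] using this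
  have h5 : (l ^ 2 / 4) • (g * g) ≤ K * star K := by
    have h6 : (l - l / 4) • ((l - 2 * η) • (g * g)) ≤ (l - l / 4) • (g * T * g) :=
      smul_le_smul_of_nonneg_left h1 (by linarith)
    have h7 : (l ^ 2 / 4) • (g * g) ≤ ((l - l / 4) * (l - 2 * η) - l ^ 2 / 4) • (g * g) :=
      smul_le_smul_of_nonneg_right (by nlinarith) hgg0
    refine h7.trans (le_trans ?_ h3)
    have h8 := sub_le_sub_right h4 ((l / 4) • (g * T * g))
    refine le_trans ?_ h8
    have h9 := sub_le_sub_right h6 ((l ^ 2 / 4) • (g * g))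
    convert h9 using 1
    · module
    · module
  obtain ⟨R, hR1, hR2⟩ := exists_mul_star_near_of_smul_le hgs (by positivity) h5 hε
  refine ⟨g * R * K, ?_, ?_, hR2, ?_⟩
  · rw [hK]; simp only [mul_assoc, hqq]
  · have h6 := CStarAlgebra.norm_le_norm_of_nonneg_of_le (mul_star_self_nonneg _) hR1
    rw [CStarRing.norm_self_mul_star] at h6
    have h7 : ‖g * g‖ ≤ 1 * 1 := (norm_mul_le _ _).trans (by gcongr)
    nlinarith [norm_nonneg (g * R * K)]
  · intro e he
    rw [mul_assoc g, ← mul_assoc, he, zero_mul]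

end CuntzComparison

section Averaging

variable {U : Type*} [CStarAlgebra U] {G : Type*} [Fintype G]

/-- The sum of the translates of an element under a finite family of *-homomorphisms. -/
noncomputable def orbitSum (β : G → U →⋆ₐ[ℂ] U) (x : U) : U := ∑ g, β g x

variable {β : G → U →⋆ₐ[ℂ] U}

lemma norm_starAlgHom_le (f : U →⋆ₐ[ℂ] U) (x : U) : ‖f x‖ ≤ ‖x‖ :=
  NonUnitalStarAlgHom.norm_apply_le f x

lemma starAlgHom_real_smul (f : U →⋆ₐ[ℂ] U) (t : ℝ) (x : U) : f (t • x) = t • f x := by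
  rw [← Complex.coe_smul, map_smul, Complex.coe_smul]

lemma star_orbitSum (x : U) : star (orbitSum β x) = orbitSum β (star x) := by
  simp only [orbitSum, star_sum, map_star]

lemma orbitSum_add (x y : U) : orbitSum β (x + y) = orbitSum β x + orbitSum β y := by
  simp only [orbitSum, map_add, Finset.sum_add_distrib]

lemma orbitSum_sub (x y : U) : orbitSum β (x - y) = orbitSum β x - orbitSum β y := by
  simp only [orbitSum, map_sub, Finset.sum_sub_distrib]

lemma orbitSum_smul (t : ℝ) (x : U) : orbitSum β (t • x) = t • orbitSum β x := by
  simp only [orbitSum, starAlgHom_real_smul, Finset.smul_sum]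

lemma norm_orbitSum_le (x : U) : ‖orbitSum β x‖ ≤ Fintype.card G * ‖x‖ := by
  refine (norm_sum_le _ _).trans ?_
  calc ∑ g, ‖β g x‖ ≤ ∑ _g : G, ‖x‖ := Finset.sum_le_sum fun g _ => norm_starAlgHom_le _ _
    _ = _ := by simp

lemma mul_orbitSum {a : U} (ha : ∀ g, β g a = a) (x : U) :
    a * orbitSum β x = orbitSum β (a * x) := by
  simp only [orbitSum, map_mul, ha, Finset.mul_sum]

lemma orbitSum_mul {a : U} (ha : ∀ g, β g a = a) (x : U) :
    orbitSum β x * a = orbitSum β (x * a) := by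
  simp only [orbitSum, map_mul, ha, Finset.sum_mul]

end Averaging

section GroupAveraging

variable {U : Type*} [CStarAlgebra U] {G : Type*} [Group G] {β : G → U →⋆ₐ[ℂ] U}

lemma mul_map_eq_zero {q x y : U} (hq : ∀ g, g ≠ 1 → q * β g q = 0) (hx : x * q = x)
    (hy : q * y = y) {g : G} (hg : g ≠ 1) : x * β g y = 0 := by
  rw [← hx, ← hy, map_mul, mul_assoc, ← mul_assoc q, hq g hg, zero_mul, mul_zero]

lemma map_mul_map_eq_zero (hβ : ∀ g h x, β (g * h) x = β g (β h x))
    {q x y : U} (hq : ∀ g, g ≠ 1 → q * β g q = 0) (hx : x * q = x)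
    (hy : q * y = y) {g h : G} (hg : g ≠ h) : β g x * β h y = 0 := by
  have h1 : β h y = β g (β (g⁻¹ * h) y) := by rw [← hβ, mul_inv_cancel_left]
  rw [h1, ← map_mul, mul_map_eq_zero hq hx hy, map_zero]
  intro h2
  exact hg (inv_mul_eq_one.mp h2)

variable [Fintype G]

lemma map_orbitSum (hβ : ∀ g h x, β (g * h) x = β g (β h x)) (g : G) (x : U) :
    β g (orbitSum β x) = orbitSum β x := by
  simp only [orbitSum, map_sum, ← hβ]
  exact Fintype.sum_equiv (Equiv.mulLeft g) _ _ fun _ => rfl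

lemma orbitSum_mul_orbitSum (hβ : ∀ g h x, β (g * h) x = β g (β h x))
    {q x y : U} (hq : ∀ g, g ≠ 1 → q * β g q = 0) (hx : x * q = x)
    (hy : q * y = y) : orbitSum β x * orbitSum β y = orbitSum β (x * y) := by
  simp only [orbitSum, Finset.sum_mul_sum, map_mul]
  refine Finset.sum_congr rfl fun g _ => ?_
  exact Finset.sum_eq_single_of_mem g (Finset.mem_univ g) fun h _ hh =>
    map_mul_map_eq_zero hβ hq hx hy hh.symm

lemma isStarProjection_orbitSum (hβ : ∀ g h x, β (g * h) x = β g (β h x))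
    {q : U} (hqp : IsStarProjection q) (hq : ∀ g, g ≠ 1 → q * β g q = 0) :
    IsStarProjection (orbitSum β q) := by
  have hqq : q * q = q := hqp.isIdempotentElem
  refine ⟨?_, ?_⟩
  · rw [IsIdempotentElem, orbitSum_mul_orbitSum hβ hq hqq hqq, hqq]
  · rw [isSelfAdjoint_iff, star_orbitSum, hqp.isSelfAdjoint.star_eq]

/-- Averaging a partial map supported on a projection with orthogonal translates. -/
lemma exists_fixed_average (hβ : ∀ g h x, β (g * h) x = β g (β h x)) {q v b : U}
    (hqp : IsStarProjection q) (hq : ∀ g, g ≠ 1 → q * β g q = 0) (hvq : v * q = v)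
    (hv1 : ‖v‖ ≤ 1) (hb : ∀ g, β g b = b) {ε : ℝ} (hvb : ‖v * star v - b‖ ≤ ε) :
    ∃ w : U, (∀ g, β g w = w) ∧ w * orbitSum β q = w ∧ ‖w‖ ≤ 1 ∧ ‖w * star w - b‖ ≤ ε ∧
      ∀ e : U, (∀ g, β g e = e) → e * v = 0 → e * w = 0 := by
  have hqq : q * q = q := hqp.isIdempotentElem
  have hqv : q * star v = star v := by
    have := congrArg star hvq
    rwa [star_mul, hqp.isSelfAdjoint.star_eq] at this
  obtain ⟨n, hn⟩ : ∃ n : ℝ, n = (Fintype.card G : ℝ) := ⟨_, rfl⟩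
  have hn0 : 0 < n := by rw [hn]; exact_mod_cast Fintype.card_pos
  set w := (√n)⁻¹ • orbitSum β v with hw
  have hww : w * star w = n⁻¹ • orbitSum β (v * star v) := by
    rw [hw, star_smul, star_trivial, star_orbitSum, smul_mul_smul_comm,
      orbitSum_mul_orbitSum hβ hq hvq hqv, ← mul_inv, Real.mul_self_sqrt hn0.le]
  have hnn : ∀ x : U, ‖n⁻¹ • orbitSum β x‖ ≤ ‖x‖ := by
    intro x
    rw [norm_smul, Real.norm_eq_abs, abs_of_pos (inv_pos.mpr hn0), inv_mul_le_iff₀ hn0]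
    exact hn ▸ norm_orbitSum_le (β := β) x
  refine ⟨w, ?_, ?_, ?_, ?_, ?_⟩
  · intro g
    rw [hw, starAlgHom_real_smul, map_orbitSum hβ]
  · rw [hw, smul_mul_assoc, orbitSum_mul_orbitSum hβ hq hvq hqq, hvq]
  · have h1 : ‖w * star w‖ ≤ 1 := by
      rw [hww]
      refine (hnn _).trans ?_
      rw [CStarRing.norm_self_mul_star]
      nlinarith [norm_nonneg v]
    rw [CStarRing.norm_self_mul_star] at h1
    nlinarith [norm_nonneg w]
  · have h1 : w * star w - b = n⁻¹ • orbitSum β (v * star v - b) := by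
      have h2 : orbitSum β b = n • b := by
        simp only [orbitSum, hb, Finset.sum_const, Finset.card_univ, hn, Nat.cast_smul_eq_nsmul]
      rw [orbitSum_sub, smul_sub, h2, smul_smul, inv_mul_cancel₀ hn0.ne', one_smul, hww]
    rw [h1]
    exact (hnn _).trans hvb
  · intro e he hev
    rw [hw, mul_smul_comm, mul_orbitSum he, hev]
    simp [orbitSum]

end GroupAveraging

section ExactTowers

variable {U : Type*} [CStarAlgebra U] [PartialOrder U] [StarOrderedRing U]
  {G : Type*} [Group G] [Fintype G]

/-- The form of the tracial Rokhlin property inherited by the unitization: towers of almost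
permuted projections in the kernel of the character `φ`. -/
def HasRokhlinTowers (φ : U →⋆ₐ[ℂ] ℂ) (β : G → U →⋆ₐ[ℂ] U) : Prop :=
  ∀ (a b : U) (ε : ℝ), 0 < ε → ∀ x h : U, φ x = 0 → φ h = 0 → 0 ≤ x → 0 ≤ h → ‖x‖ = 1 →
    ∃ p : G → U,
      (∀ g, IsStarProjection (p g)) ∧ (∀ g, φ (p g) = 0) ∧
      (∀ g k, g ≠ k → p g * p k = 0) ∧
      (∀ g, ‖p g * a - a * p g‖ < ε) ∧ (∀ g, ‖p g * b - b * p g‖ < ε) ∧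
      (∀ g k, ‖β g (p k) - p (g * k)‖ < ε) ∧
      (∃ u : U, h * h - h * (∑ g, p g) * h ≤ u * x * star u + ε • (1 : U)) ∧
      1 - ε < ‖(∑ g, p g) * x * (∑ g, p g)‖

/-- The towers can be chosen exactly permuted and orthogonal to a given invariant projection. -/
lemma HasRokhlinTowers.exists_exact {φ : U →⋆ₐ[ℂ] ℂ} {β : G → U →⋆ₐ[ℂ] U}
    (hT : HasRokhlinTowers φ β) (hβ1 : ∀ x, β 1 x = x)
    (hβ : ∀ g h x, β (g * h) x = β g (β h x)) {r a x h : U} (hr : IsStarProjection r)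
    (hrβ : ∀ g, β g r = r) (har : a * r = r * a) (hφx : φ x = 0) (hφh : φ h = 0)
    (hx : 0 ≤ x) (hx1 : ‖x‖ = 1) (hh : 0 ≤ h) (hhr : h * r = 0) {ε : ℝ} (hε : 0 < ε) :
    ∃ p : U, IsStarProjection p ∧ φ p = 0 ∧ p * r = 0 ∧ (∀ g, g ≠ 1 → p * β g p = 0) ∧
      ‖p * a - a * p‖ < ε ∧
      (∃ u : U, h * h - h * orbitSum β p * h ≤ u * x * star u + ε • (1 : U)) ∧
      (r = 0 → 1 - ε < ‖orbitSum β p * x * orbitSum β p‖) := by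
  classical
  obtain ⟨n, hn⟩ : ∃ n : ℝ, n = (Fintype.card G : ℝ) := ⟨_, rfl⟩
  have hn1 : 1 ≤ n := by
    rw [hn]; exact_mod_cast Nat.one_le_iff_ne_zero.mpr Fintype.card_ne_zero
  have hn0 : 0 < n := by linarith
  obtain ⟨N, hN⟩ : ∃ N : ℝ, N = n * (42 * n + 3) := ⟨_, rfl⟩
  have hN1 : 42 * n + 3 ≤ N := by rw [hN]; nlinarith
  have hN0 : 0 < N := by linarith
  obtain ⟨C, hC⟩ : ∃ C : ℝ, C = 1 + 2 * ‖a‖ * N + ‖h‖ ^ 2 * N + (1 + n) * N := ⟨_, rfl⟩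
  have hC0 : 0 < C := by rw [hC]; positivity
  obtain ⟨δ, hδ⟩ : ∃ δ, δ = min (1 / (28 * n)) (ε / (2 * C)) := ⟨_, rfl⟩
  have hδ0 : 0 < δ := hδ ▸ lt_min (by positivity) (by positivity)
  have hδn : n * (7 * δ) ≤ 1 / 4 := by
    have : δ ≤ 1 / (28 * n) := hδ ▸ min_le_left _ _
    rw [le_div_iff₀ (by positivity)] at this
    linarith
  have hδC : δ * C < ε := by
    have : δ ≤ ε / (2 * C) := hδ ▸ min_le_right _ _
    rw [le_div_iff₀ (by positivity)] at this
    linarith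
  have hδ4 : δ < 1 / 4 := by nlinarith
  obtain ⟨P, hP, hφP, hPP, hPa, hPr, hPβ, ⟨u, hu⟩, hPx⟩ :=
    hT a r δ hδ0 x h hφx hφh hx hh hx1
  have hrr : r * r = r := hr.isIdempotentElem
  obtain ⟨t, ht⟩ : ∃ t, t = 1 - r := ⟨_, rfl⟩
  have htp : IsStarProjection t := ht ▸ hr.one_sub
  have htt : t * t = t := htp.isIdempotentElem
  have htr : t * r = 0 := ht ▸ hr.one_sub_mul_self
  have htβ : ∀ g, β g t = t := fun g => by rw [ht, map_sub, map_one, hrβ]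
  have hta : t * a = a * t := by rw [ht, sub_mul, mul_sub, har, one_mul, mul_one]
  have ht1 := htp.norm_le
  have hht : h * t = h := by rw [ht, mul_sub, hhr, mul_one, sub_zero]
  have hth : t * h = h := by
    have := congrArg star hht
    rwa [star_mul, htp.isSelfAdjoint.star_eq, (IsSelfAdjoint.of_nonneg hh).star_eq] at this
  have hrPt : ∀ g, ‖r * P g * t‖ ≤ δ := by
    intro g
    have h1 : r * P g * t = r * -(P g * r - r * P g) := by
      rw [ht]
      simp only [mul_sub, mul_neg, mul_one, ← mul_assoc, hrr]
      abel
    rw [h1]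
    calc _ ≤ ‖r‖ * ‖-(P g * r - r * P g)‖ := norm_mul_le _ _
      _ ≤ 1 * δ := by
        rw [norm_neg]
        exact mul_le_mul hr.norm_le (hPr g).le (norm_nonneg _) zero_le_one
      _ = δ := one_mul _
  have htP : ∀ g, ‖t * P g‖ ≤ 1 := fun g => (norm_mul_le _ _).trans
    (mul_le_one₀ ht1 (norm_nonneg _) (hP g).norm_le)
  have hmul : ∀ g k, ‖t * P g * (r * P k * t)‖ ≤ δ := by
    intro g k
    calc _ ≤ ‖t * P g‖ * ‖r * P k * t‖ := norm_mul_le _ _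
      _ ≤ 1 * δ := mul_le_mul (htP g) (hrPt k) (norm_nonneg _) zero_le_one
      _ = δ := one_mul _
  obtain ⟨Q, hQ⟩ : ∃ Q : G → U, Q = fun g => t * P g * t := ⟨_, rfl⟩
  have hQn : ∀ g, ‖Q g‖ ≤ 1 := fun g => by
    rw [hQ]; exact (htp.norm_conj_le _).trans (hP g).norm_le
  have hQQ : ∀ g k, Q g * Q k = t * (P g * P k) * t - t * P g * (r * P k * t) := by
    intro g k
    have h1 : Q g * Q k = t * P g * (t * t) * P k * t := by rw [hQ]; simp only [mul_assoc]
    rw [h1, htt]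
    nth_rewrite 2 [ht]
    simp only [mul_sub, sub_mul, mul_one, mul_assoc]
  have hQs : IsSelfAdjoint (Q 1) := by
    rw [isSelfAdjoint_iff, hQ]
    simp only [star_mul, htp.isSelfAdjoint.star_eq, (hP 1).isSelfAdjoint.star_eq, mul_assoc]
  have hQ1 : ‖Q 1 * Q 1 - Q 1‖ ≤ δ := by
    rw [hQQ, (hP 1).isIdempotentElem, hQ]
    simp only [sub_sub_cancel_left, norm_neg]
    exact hmul 1 1
  obtain ⟨q, k, hq, hqQ, hqk⟩ := exists_isStarProjection_near hQs hQ1 hδ4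
  have hqt : q * t = q := by rw [hqk, hQ]; simp only [mul_assoc, htt]
  have hqr : q * r = 0 := by rw [← hqt, mul_assoc, htr, mul_zero]
  have hrq : r * q = 0 := by
    have := congrArg star hqr
    rwa [star_mul, hr.isSelfAdjoint.star_eq, hq.isSelfAdjoint.star_eq, star_zero] at this
  have hφq : φ q = 0 := by
    rw [hqk, hQ]
    simp only [map_mul, hφP, mul_zero, zero_mul]
  have hβq : ∀ g, IsStarProjection (β g q) := fun g => hq.map (β g)
  have hβQ : ∀ g, ‖β g q - Q g‖ ≤ 3 * δ := by
    intro g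
    have h1 : β g q - Q g = β g (q - Q 1) + t * (β g (P 1) - P (g * 1)) * t := by
      rw [hQ]
      simp only [map_sub, map_mul, htβ, mul_one, mul_sub, sub_mul]
      abel
    have h2 := norm_starAlgHom_le (β g) (q - Q 1)
    have h3 := htp.norm_conj_le (β g (P 1) - P (g * 1))
    have h4 := hPβ g 1
    rw [h1]
    refine (norm_add_le _ _).trans ?_
    linarith
  have hqq : ∀ g k, g ≠ k → ‖β g q * β k q‖ ≤ 7 * δ := by
    intro g k hgk
    have h1 : β g q * β k q = (β g q - Q g) * β k q + Q g * (β k q - Q k) + Q g * Q k := by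
      simp only [mul_sub, sub_mul]; abel
    have h2 : ‖(β g q - Q g) * β k q‖ ≤ 3 * δ * 1 := (norm_mul_le _ _).trans
      (mul_le_mul (hβQ g) (hβq k).norm_le (norm_nonneg _) (by positivity))
    have h3 : ‖Q g * (β k q - Q k)‖ ≤ 1 * (3 * δ) := (norm_mul_le _ _).trans
      (mul_le_mul (hQn g) (hβQ k) (norm_nonneg _) (by positivity))
    have h4 : ‖Q g * Q k‖ ≤ δ := by
      rw [hQQ, hPP g k hgk, mul_zero, zero_mul, zero_sub, norm_neg]
      exact hmul g k
    rw [h1]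
    refine (norm_add₃_le).trans ?_
    linarith
  have hcut := mul_cfc_invSqrtCut_mul hβq (by positivity : 0 ≤ 7 * δ) hqq (by rwa [← hn])
  set S := ∑ g, β g q with hS
  have hSs : IsSelfAdjoint S := by
    rw [isSelfAdjoint_iff, hS, star_sum]
    exact Finset.sum_congr rfl fun g _ => (hβq g).isSelfAdjoint
  set w := cfc invSqrtCut S with hw
  have hws : IsSelfAdjoint w := cfc_predicate _ S
  have hSβ : ∀ g, β g S = S := map_orbitSum hβ (x := q)
  have hwβ : ∀ g, β g w = w := fun g => by
    rw [hw, StarAlgHomClass.map_cfc (β g) invSqrtCut S continuous_invSqrtCut.continuousOn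
      (hφa := (hSβ g).symm ▸ hSs), hSβ g]
  have hw2 : ‖w‖ ≤ 2 := norm_cfc_le zero_le_two fun s _ => by
    rw [Real.norm_eq_abs, abs_of_nonneg (invSqrtCut_nonneg _)]; exact invSqrtCut_le_two _
  have hqwwq : q * (w * w) * q = q := by
    have := hcut 1 1
    rwa [if_pos rfl, hβ1] at this
  have hqwwβ : ∀ g, g ≠ 1 → q * (w * w) * β g q = 0 := by
    intro g hg
    have := hcut 1 g
    rwa [if_neg hg.symm, hβ1] at this
  have hSq : ‖S * q - (1 : ℝ) • q‖ ≤ n * (7 * δ) := by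
    have h1 : S * q - (1 : ℝ) • q = ∑ g ∈ Finset.univ.erase (1 : G), β g q * q := by
      rw [hS, Finset.sum_mul, ← Finset.add_sum_erase _ _ (Finset.mem_univ (1 : G)), hβ1,
        hq.isIdempotentElem, one_smul, add_sub_cancel_left]
    rw [h1]
    calc _ ≤ ∑ g ∈ Finset.univ.erase (1 : G), ‖β g q * q‖ := norm_sum_le _ _
      _ ≤ ∑ _g ∈ Finset.univ.erase (1 : G), 7 * δ := Finset.sum_le_sum fun g hg => by
          have := hqq g 1 (Finset.ne_of_mem_erase hg)
          rwa [hβ1] at this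
      _ ≤ ∑ _g : G, 7 * δ := Finset.sum_le_sum_of_subset_of_nonneg (Finset.erase_subset _ _)
          fun _ _ _ => by positivity
      _ = n * (7 * δ) := by rw [Finset.sum_const, Finset.card_univ, nsmul_eq_mul, hn]
  have hwq : ‖w * q - q‖ ≤ 14 * n * δ := by
    have h1 := norm_cfc_mul_sub_le hSs (f := invSqrtCut) (t := 1) (C := 2)
      continuous_invSqrtCut.continuousOn zero_le_two
      (fun s _ => by rw [invSqrtCut_one]; exact abs_invSqrtCut_sub_one_le s) q
    rw [invSqrtCut_one, one_smul] at h1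
    rw [one_smul] at hSq
    refine h1.trans ?_
    linarith
  set p := w * q * w with hp
  have hqs : star q = q := hq.isSelfAdjoint
  have hps : IsSelfAdjoint p := by
    rw [isSelfAdjoint_iff, hp]
    simp only [star_mul, hqs, hws.star_eq, mul_assoc]
  have hpp : IsStarProjection p := by
    refine ⟨?_, hps⟩
    calc p * p = w * (q * (w * w) * q) * w := by rw [hp]; simp only [mul_assoc]
      _ = p := by rw [hqwwq]
  have hpβ : ∀ g, g ≠ 1 → p * β g p = 0 := by
    intro g hg
    calc p * β g p = w * (q * (w * w) * β g q) * w := by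
          rw [hp]; simp only [map_mul, hwβ, mul_assoc]
      _ = 0 := by rw [hqwwβ g hg, mul_zero, zero_mul]
  have hpq : ‖p - q‖ ≤ 42 * n * δ := by
    have h1 : p - q = (w * q - q) * w + star (w * q - q) := by
      rw [hp, star_sub, star_mul, hqs, hws.star_eq, sub_mul]; abel
    have h2 : ‖(w * q - q) * w‖ ≤ 14 * n * δ * 2 := (norm_mul_le _ _).trans
      (mul_le_mul hwq hw2 (norm_nonneg _) (by positivity))
    rw [h1]
    refine (norm_add_le _ _).trans ?_
    rw [norm_star]
    linarith
  have hφp : φ p = 0 := by rw [hp, map_mul, map_mul, hφq, mul_zero, zero_mul]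
  have hpr : p * r = 0 := by
    have h1 : S * r = (0 : ℝ) • r := by
      rw [hS, Finset.sum_mul, zero_smul]
      refine Finset.sum_eq_zero fun g _ => ?_
      rw [← hrβ g, ← map_mul, hqr, map_zero]
    have h2 : w * r = invSqrtCut 0 • r := by
      refine cfc_mul_eq_smul hSs (C := 4) continuous_invSqrtCut.continuousOn (by norm_num)
        (fun s _ => ?_) h1
      rcases le_total s (1 / 2) with hs | hs
      · rw [invSqrtCut, invSqrtCut, max_eq_right hs, max_eq_right (by norm_num), sub_self, abs_zero]
        positivity
      · rw [sub_zero, abs_of_pos (by linarith : 0 < s), abs_le]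
        constructor <;> linarith [invSqrtCut_nonneg s, invSqrtCut_nonneg 0, invSqrtCut_le_two s,
          invSqrtCut_le_two 0]
    rw [hp, mul_assoc, h2, mul_smul_comm, mul_assoc, hqr, mul_zero, smul_zero]
  have hpQ : ∀ g, ‖β g p - Q g‖ ≤ (42 * n + 3) * δ := by
    intro g
    have h1 : β g p - Q g = β g (p - q) + (β g q - Q g) := by rw [map_sub]; abel
    rw [h1]
    refine (norm_add_le _ _).trans ?_
    linarith [norm_starAlgHom_le (β g) (p - q), hβQ g]
  have heQ : ‖orbitSum β p - ∑ g, Q g‖ ≤ N * δ := by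
    rw [orbitSum, ← Finset.sum_sub_distrib]
    calc _ ≤ ∑ g : G, ‖β g p - Q g‖ := norm_sum_le _ _
      _ ≤ ∑ _g : G, (42 * n + 3) * δ := Finset.sum_le_sum fun g _ => hpQ g
      _ = N * δ := by rw [Finset.sum_const, Finset.card_univ, nsmul_eq_mul, ← hn, hN, mul_assoc]
  have hsumQ : ∑ g, Q g = t * (∑ g, P g) * t := by
    rw [hQ, Finset.mul_sum, Finset.sum_mul]
  have hep := isStarProjection_orbitSum hβ hpp hpβ
  refine ⟨p, hpp, hφp, hpr, hpβ, ?_, ?_, ?_⟩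
  · have h1 : p * a - a * p = (p - Q 1) * a - a * (p - Q 1) + t * (P 1 * a - a * P 1) * t := by
      have h2 : Q 1 * a = t * (P 1 * a) * t := by rw [hQ]; simp only [mul_assoc, hta]
      have h3 : a * Q 1 = t * (a * P 1) * t := by
        rw [hQ]; simp only [← mul_assoc, hta]
      simp only [sub_mul, mul_sub, h2, h3]
      abel
    have h2 : ‖p - Q 1‖ ≤ N * δ := by
      have := hpQ 1
      rw [hβ1] at this
      exact this.trans (mul_le_mul_of_nonneg_right hN1 hδ0.le)
    have h3 : ‖(p - Q 1) * a‖ ≤ N * δ * ‖a‖ := (norm_mul_le _ _).trans (by gcongr)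
    have h4 : ‖a * (p - Q 1)‖ ≤ ‖a‖ * (N * δ) := (norm_mul_le _ _).trans (by gcongr)
    have h5 := (htp.norm_conj_le (P 1 * a - a * P 1)).trans (hPa 1).le
    rw [h1]
    refine lt_of_le_of_lt ((norm_add_le _ _).trans (add_le_add (norm_sub_le _ _) le_rfl)) ?_
    have h6 : 0 ≤ (‖h‖ ^ 2 * N + (1 + n) * N) * δ := by positivity
    rw [hC] at hδC
    linarith
  · refine ⟨u, ?_⟩
    have h1 : h * h - h * orbitSum β p * h = (h * h - h * (∑ g, P g) * h)
        + h * (∑ g, Q g - orbitSum β p) * h := by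
      have h2 : h * (∑ g, Q g) * h = h * (∑ g, P g) * h := by
        rw [hsumQ]
        calc _ = (h * t) * (∑ g, P g) * (t * h) := by simp only [mul_assoc]
          _ = _ := by rw [hht, hth]
      rw [mul_sub, sub_mul, h2]
      abel
    have hhs : IsSelfAdjoint h := .of_nonneg hh
    have h3 : h * (∑ g, Q g - orbitSum β p) * h ≤ (‖h‖ ^ 2 * (N * δ)) • (1 : U) := by
      refine IsSelfAdjoint.le_smul_one ?_ ?_
      · have h4 : IsSelfAdjoint (∑ g, Q g - orbitSum β p) := by
          refine IsSelfAdjoint.sub ?_ hep.isSelfAdjoint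
          rw [isSelfAdjoint_iff, hsumQ]
          simp only [star_mul, star_sum, htp.isSelfAdjoint.star_eq, (hP _).isSelfAdjoint.star_eq,
            mul_assoc]
        rw [isSelfAdjoint_iff]
        simp only [star_mul, hhs.star_eq, h4.star_eq, mul_assoc]
      · calc _ ≤ ‖h‖ * ‖∑ g, Q g - orbitSum β p‖ * ‖h‖ := norm_mul₃_le
          _ ≤ ‖h‖ * (N * δ) * ‖h‖ := by rw [norm_sub_rev]; gcongr
          _ = _ := by ring
    rw [h1]
    refine (add_le_add hu h3).trans ?_
    rw [add_assoc, ← add_smul]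
    refine add_le_add le_rfl (smul_le_smul_of_nonneg_right ?_ zero_le_one)
    have h6 : 0 ≤ (2 * ‖a‖ * N + (1 + n) * N) * δ := by positivity
    rw [hC] at hδC
    linarith
  · intro hr0
    have h1 : ∑ g, Q g = ∑ g, P g := by rw [hsumQ, ht, hr0]; simp
    rw [h1] at heQ
    set E := ∑ g, P g with hE
    set e := orbitSum β p with he
    have hEn : ‖E‖ ≤ n := by
      refine (norm_sum_le _ _).trans ((Finset.sum_le_sum fun g _ => (hP g).norm_le).trans ?_)
      rw [Finset.sum_const, Finset.card_univ, nsmul_eq_mul, hn, mul_one]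
    have h2 : E * x * E = e * x * e - (e - E) * x * E - e * x * (e - E) := by
      simp only [mul_sub, sub_mul]; abel
    have h3 : ‖(e - E) * x * E‖ ≤ N * δ * 1 * n := norm_mul₃_le.trans (by rw [hx1]; gcongr)
    have h4 : ‖e * x * (e - E)‖ ≤ 1 * 1 * (N * δ) := norm_mul₃_le.trans (by
      have := hep.norm_le
      rw [hx1]; gcongr)
    have h5 := norm_sub_le (e * x * e - (e - E) * x * E) (e * x * (e - E))
    have h6 := norm_sub_le (e * x * e) ((e - E) * x * E)
    rw [← h2] at h5
    have h7 : 0 ≤ (2 * ‖a‖ * N + ‖h‖ ^ 2 * N) * δ := by positivity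
    rw [hC] at hδC
    linarith

end ExactTowers

section Core

variable {U : Type*} [CStarAlgebra U]

lemma map_cfc_eq_zero {φ : U →⋆ₐ[ℂ] ℂ} {x : U} (hx : IsSelfAdjoint x) {l : ℝ}
    (hl : φ x = (l : ℂ)) {f : ℝ → ℝ} (hf : Continuous f) (hfl : f l = 0) : φ (cfc f x) = 0 := by
  have hl' : φ x = algebraMap ℝ ℂ l := hl
  rw [StarAlgHomClass.map_cfc φ f x hf.continuousOn (hφa := hx.map φ), hl', cfc_algebraMap, hfl,
    map_zero]

lemma isUnit_of_isSelfAdjoint_of_mul_eq_one {y z : U} (hy : IsSelfAdjoint y) (h : y * z = 1) :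
    IsUnit y := by
  have h1 : star z * y = 1 := by
    have := congrArg star h
    rwa [star_mul, hy.star_eq, star_one] at this
  have h2 : star z = z := by
    calc star z = star z * (y * z) := by rw [h, mul_one]
      _ = z := by rw [← mul_assoc, h1, one_mul]
  exact ⟨⟨y, z, h, h2 ▸ h1⟩, rfl⟩

variable [PartialOrder U] [StarOrderedRing U]

lemma orbitSum_le_orbitSum {G : Type*} [Fintype G] {β : G → U →⋆ₐ[ℂ] U} {x y : U} (h : x ≤ y) :
    orbitSum β x ≤ orbitSum β y := by
  rw [← sub_nonneg, ← orbitSum_sub]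
  exact Finset.sum_nonneg fun g _ => map_nonneg (β g) (sub_nonneg.mpr h)

variable {G : Type*} [Group G] [Fintype G]

/-- An invariant non-invertible self-adjoint element is almost annihilated by a nonzero
projection with orthogonal translates. -/
lemma HasRokhlinTowers.exists_small_projection {φ : U →⋆ₐ[ℂ] ℂ} {β : G → U →⋆ₐ[ℂ] U}
    (hT : HasRokhlinTowers φ β)
    (hRR : ∀ x : U, IsSelfAdjoint x → ∀ ε : ℝ, 0 < ε →
      ∃ y : U, IsSelfAdjoint y ∧ IsUnit y ∧ ‖x - y‖ < ε)
    (hβ1 : ∀ x, β 1 x = x) (hβ : ∀ g h x, β (g * h) x = β g (β h x))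
    {x : U} (hx : IsSelfAdjoint x) (hxβ : ∀ g, β g x = x) (hxu : ¬ IsUnit x) {l : ℝ} (hl : 0 < l)
    (hφx : φ x = (l : ℂ)) {ε : ℝ} (hε : 0 < ε) :
    ∃ q : U, IsStarProjection q ∧ q ≠ 0 ∧ φ q = 0 ∧ (∀ g, g ≠ 1 → q * β g q = 0) ∧
      ‖x * q‖ < ε := by
  obtain ⟨n, hn⟩ : ∃ n : ℝ, n = (Fintype.card G : ℝ) := ⟨_, rfl⟩
  have hn0 : 0 < n := by rw [hn]; exact_mod_cast Fintype.card_pos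
  obtain ⟨ε₁, hε₁⟩ : ∃ ε₁, ε₁ = min (ε / 2) l := ⟨_, rfl⟩
  have hε₁0 : 0 < ε₁ := hε₁ ▸ lt_min (by linarith) hl
  have hε₁1 : ε₁ ≤ ε / 2 := hε₁ ▸ min_le_left _ _
  have hε₁2 : ε₁ ≤ l := hε₁ ▸ min_le_right _ _
  obtain ⟨s, hs⟩ : ∃ s, s = min (1 / 2) (ε / (4 * (‖x‖ + 1))) := ⟨_, rfl⟩
  have hs0 : 0 < s := hs ▸ lt_min (by norm_num) (by positivity)
  have hs1 : s ≤ 1 / 2 := hs ▸ min_le_left _ _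
  have hs2 : ‖x‖ * s ≤ ε / 4 := by
    have h1 : s ≤ ε / (4 * (‖x‖ + 1)) := hs ▸ min_le_right _ _
    rw [le_div_iff₀ (by positivity)] at h1
    nlinarith
  obtain ⟨f, hf⟩ : ∃ f : ℝ → ℝ, f = fun t => max 0 (1 - |t| / ε₁) := ⟨_, rfl⟩
  have hfc : Continuous f := by rw [hf]; fun_prop
  have hf0 : ∀ t, 0 ≤ f t := fun t => by rw [hf]; exact le_max_left _ _
  have hf1 : ∀ t, f t ≤ 1 := fun t => by
    rw [hf]; exact max_le zero_le_one (sub_le_self _ (by positivity))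
  have hfz : ∀ t, ε₁ ≤ |t| → f t = 0 := fun t ht => by
    rw [hf]
    refine max_eq_left (sub_nonpos.mpr ?_)
    rwa [one_le_div₀ hε₁0]
  set b := cfc f x with hb
  have hb0 : 0 ≤ b := cfc_nonneg fun t _ => hf0 t
  have hφb : φ b = 0 := map_cfc_eq_zero hx hφx hfc (hfz l (hε₁2.trans (le_abs_self l)))
  have hbn : ‖b‖ = 1 := by
    refine le_antisymm (norm_cfc_le zero_le_one fun t _ => ?_) ?_
    · rw [Real.norm_eq_abs, abs_of_nonneg (hf0 t)]; exact hf1 t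
    · have h0 : (0 : ℝ) ∈ spectrum ℝ x := by rwa [spectrum.zero_mem_iff]
      have h1 := norm_apply_le_norm_cfc f x h0
      have h2 : f 0 = 1 := by simp [hf]
      rwa [h2, norm_one] at h1
  have hxb : ‖x * b‖ ≤ ε₁ := by
    have h1 : x * b = cfc (fun t => t * f t) x := by
      rw [cfc_mul .., cfc_id' ℝ x]
    rw [h1]
    refine norm_cfc_le hε₁0.le fun t _ => ?_
    rw [Real.norm_eq_abs, abs_mul, abs_of_nonneg (hf0 t)]
    rcases le_total ε₁ |t| with h | h
    · rw [hfz t h, mul_zero]; exact hε₁0.le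
    · nlinarith [hf0 t, hf1 t, abs_nonneg t]
  have hbβ : ∀ g, β g b = b := fun g => by
    rw [hb, StarAlgHomClass.map_cfc (β g) f x hfc.continuousOn (hφa := (hxβ g).symm ▸ hx), hxβ]
  obtain ⟨δ, hδ⟩ : ∃ δ, δ = s ^ 2 / (n + 1) := ⟨_, rfl⟩
  have hδ0 : 0 < δ := by rw [hδ]; positivity
  have hδn : n * δ + δ = s ^ 2 := by rw [hδ]; field_simp
  obtain ⟨p, hp, hφp, -, hpβ, hpb, -, hpe⟩ := hT.exists_exact hβ1 hβ (r := 0) (a := b) (h := 0)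
    (.zero U) (fun g => map_zero _) (by simp) hφb (map_zero _) hb0 hbn le_rfl (by simp) hδ0
  have hpe := hpe rfl
  have hpp : p * p = p := hp.isIdempotentElem
  obtain ⟨d, hd⟩ : ∃ d, d = p * b * p := ⟨_, rfl⟩
  have hpd : p * d = d := by rw [hd, ← mul_assoc, ← mul_assoc, hpp]
  have hdp : d * p = d := by rw [hd, mul_assoc, hpp]
  have hd0 : 0 ≤ d := by
    have := hp.conj_le_conj hb0
    rwa [mul_zero, zero_mul, ← hd] at this
  have he := isStarProjection_orbitSum hβ hp hpβ
  set e := orbitSum β p with hedef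
  have hee : e * e = e := he.isIdempotentElem
  have heD : e * orbitSum β d = orbitSum β d := by
    rw [hedef, orbitSum_mul_orbitSum hβ hpβ hpp hpd, hpd]
  have hDn : ‖orbitSum β d‖ ≤ ‖d‖ := by
    have h1 : d ≤ ‖d‖ • p := by
      have h2 := hp.conj_le_conj ((IsSelfAdjoint.of_nonneg hd0).le_smul_one le_rfl)
      rwa [hpd, hdp, mul_smul_comm, mul_one, smul_mul_assoc, hpp] at h2
    have h3 := orbitSum_le_orbitSum (β := β) h1
    rw [orbitSum_smul] at h3
    have h4 : 0 ≤ orbitSum β d := by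
      have := orbitSum_le_orbitSum (β := β) hd0
      simpa [orbitSum] using this
    refine (CStarAlgebra.norm_le_norm_of_nonneg_of_le h4 h3).trans ?_
    rw [norm_smul, norm_norm]
    exact mul_le_of_le_one_right (norm_nonneg _) he.norm_le
  have hdn : 1 - s ^ 2 < ‖d‖ := by
    have h1 : e * b * e = orbitSum β d + e * orbitSum β ((b * p - p * b) * p) := by
      have h2 : b * p = d + (b * p - p * b) * p := by
        rw [hd, sub_mul, mul_assoc b p p, hpp]; abel
      rw [mul_assoc, hedef, mul_orbitSum hbβ, ← hedef]
      conv_lhs => rw [h2]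
      rw [orbitSum_add, mul_add, heD]
    have h2 : ‖e * orbitSum β ((b * p - p * b) * p)‖ ≤ 1 * (n * (δ * 1)) := by
      refine (norm_mul_le _ _).trans (mul_le_mul he.norm_le ?_ (norm_nonneg _) zero_le_one)
      rw [hn]
      refine (norm_orbitSum_le _).trans (mul_le_mul_of_nonneg_left ?_ (by positivity))
      refine (norm_mul_le _ _).trans (mul_le_mul ?_ hp.norm_le (norm_nonneg _) hδ0.le)
      rw [norm_sub_rev]
      exact hpb.le
    rw [h1] at hpe
    have h3 := norm_add_le (orbitSum β d) (e * orbitSum β ((b * p - p * b) * p))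
    linarith
  obtain ⟨q, hq, hq0, hpq, hqp, hqd⟩ := exists_projection_of_lt_norm hRR hp hd0
    (by rw [hpd, hdp]) (by nlinarith : 0 < 1 - s ^ 2) hdn
  have hqq : q * q = q := hq.isIdempotentElem
  have hqs : star q = q := hq.isSelfAdjoint
  refine ⟨q, hq, hq0, ?_, fun g hg => mul_map_eq_zero hpβ hqp hpq hg, ?_⟩
  · rw [← hpq, map_mul, hφp, zero_mul]
  · have hqb : (1 - s ^ 2) • q ≤ q * b * q := by
      refine hqd.trans_eq ?_
      rw [hd]
      calc _ = (q * p) * b * (p * q) := by simp only [mul_assoc]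
        _ = _ := by rw [hqp, hpq]
    set y := 1 - b with hy
    have hys : IsSelfAdjoint y := (IsSelfAdjoint.one U).sub (.of_nonneg hb0)
    have hyy : y * y ≤ y := by
      have h1 : y = cfc (fun t => 1 - f t) x := by
        rw [cfc_sub .., cfc_const_one ℝ x]
      rw [h1, ← cfc_mul ..]
      exact cfc_mono fun t _ => by nlinarith [hf0 t, hf1 t]
    have hyq : ‖y * q‖ ≤ s := by
      have h1 : star (y * q) * (y * q) ≤ (s ^ 2) • (1 : U) := by
        have h2 : star (y * q) * (y * q) = q * (y * y) * q := by
          rw [star_mul, hys.star_eq, hqs]; simp only [mul_assoc]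
        rw [h2]
        refine (hq.conj_le_conj hyy).trans ?_
        have h3 : q * y * q = q - q * b * q := by rw [hy, mul_sub, sub_mul, mul_one, hqq]
        rw [h3]
        have h4 : q - q * b * q ≤ (s ^ 2) • q := by
          have := sub_le_sub_left hqb q
          refine this.trans_eq ?_
          module
        exact h4.trans (smul_le_smul_of_nonneg_left hq.le_one (by positivity))
      have h5 : ‖star (y * q) * (y * q)‖ ≤ s ^ 2 := by
        rw [CStarAlgebra.norm_le_iff_le_algebraMap _ (by positivity) (star_mul_self_nonneg _),
          Algebra.algebraMap_eq_smul_one]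
        exact h1
      rw [CStarRing.norm_star_mul_self] at h5
      exact le_of_sq_le_sq (by nlinarith) hs0.le
    have h1 : x * q = x * b * q + x * (y * q) := by
      rw [hy]; simp only [mul_sub, sub_mul, one_mul, mul_assoc]; abel
    have h2 : ‖x * b * q‖ ≤ ε₁ * 1 := (norm_mul_le _ _).trans
      (mul_le_mul hxb hq.norm_le (norm_nonneg _) hε₁0.le)
    have h3 : ‖x * (y * q)‖ ≤ ‖x‖ * s := (norm_mul_le _ _).trans (by gcongr)
    rw [h1]
    refine lt_of_le_of_lt (norm_add_le _ _) ?_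
    linarith

lemma HasRokhlinTowers.exists_fixed_unit_of_pos {φ : U →⋆ₐ[ℂ] ℂ} {β : G → U →⋆ₐ[ℂ] U}
    (hT : HasRokhlinTowers φ β)
    (hRR : ∀ x : U, IsSelfAdjoint x → ∀ ε : ℝ, 0 < ε →
      ∃ y : U, IsSelfAdjoint y ∧ IsUnit y ∧ ‖x - y‖ < ε)
    (hβ1 : ∀ x, β 1 x = x) (hβ : ∀ g h x, β (g * h) x = β g (β h x))
    {x : U} (hx : IsSelfAdjoint x) (hxβ : ∀ g, β g x = x) {l : ℝ} (hl : 0 < l)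
    (hφx : φ x = (l : ℂ)) {ε : ℝ} (hε : 0 < ε) :
    ∃ y : U, IsSelfAdjoint y ∧ (∀ g, β g y = y) ∧ IsUnit y ∧ ‖x - y‖ < ε := by
  by_cases hxu : IsUnit x
  · exact ⟨x, hx, hxβ, hxu, by simpa using hε⟩
  obtain ⟨n, hn⟩ : ∃ n : ℝ, n = (Fintype.card G : ℝ) := ⟨_, rfl⟩
  have hn0 : 0 < n := by rw [hn]; exact_mod_cast Fintype.card_pos
  obtain ⟨η, hη⟩ : ∃ η, η = min (l / 8) (ε / 40) := ⟨_, rfl⟩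
  have hη0 : 0 < η := hη ▸ lt_min (by linarith) (by linarith)
  have hηl : 8 * η ≤ l := by
    have : η ≤ l / 8 := hη ▸ min_le_left _ _
    linarith
  have hηε : 5 * η ≤ ε / 8 := by
    have : η ≤ ε / 40 := hη ▸ min_le_right _ _
    linarith
  obtain ⟨δ, hδ⟩ : ∃ δ, δ = min (l / 4) (ε / (16 * n)) := ⟨_, rfl⟩
  have hδ0 : 0 < δ := hδ ▸ lt_min (by linarith) (by positivity)
  have hδl : δ ≤ l / 4 := hδ ▸ min_le_left _ _
  have hδε : n * δ ≤ ε / 16 := by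
    have : δ ≤ ε / (16 * n) := hδ ▸ min_le_right _ _
    rw [le_div_iff₀ (by positivity)] at this
    linarith
  have hnorm : ∀ y : U, ‖y‖ ≤ δ → ‖orbitSum β y‖ ≤ ε / 16 := fun y hy => by
    refine (norm_orbitSum_le y).trans ?_
    rw [← hn]
    exact (mul_le_mul_of_nonneg_left hy hn0.le).trans hδε
  obtain ⟨q, hq, hq0, hφq, hqβ, hxq⟩ :=
    hT.exists_small_projection hRR hβ1 hβ hx hxβ hxu hl hφx hδ0
  have hr := isStarProjection_orbitSum hβ hq hqβ
  have hrβ := fun g => map_orbitSum hβ g q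
  have hxr : ‖x * orbitSum β q‖ ≤ ε / 16 := by
    rw [mul_orbitSum hxβ]; exact hnorm _ hxq.le
  set r := orbitSum β q with hrdef
  have hrr : r * r = r := hr.isIdempotentElem
  have hrs : star r = r := hr.isSelfAdjoint
  obtain ⟨t, ht⟩ : ∃ t, t = 1 - r := ⟨_, rfl⟩
  have htp : IsStarProjection t := ht ▸ hr.one_sub
  have htr : t * r = 0 := ht ▸ hr.one_sub_mul_self
  have hrt : r * t = 0 := ht ▸ hr.mul_one_sub_self
  have htt : t * t = t := htp.isIdempotentElem
  have htβ : ∀ g, β g t = t := fun g => by rw [ht, map_sub, map_one, hrβ]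
  obtain ⟨a, ha⟩ : ∃ a, a = t * (x - l • 1) * t := ⟨_, rfl⟩
  have has : IsSelfAdjoint a := by
    have h1 : IsSelfAdjoint (x - l • (1 : U)) :=
      hx.sub ((IsSelfAdjoint.all l).smul (IsSelfAdjoint.one U))
    rw [isSelfAdjoint_iff, ha]
    simp only [star_mul, htp.isSelfAdjoint.star_eq, h1.star_eq, mul_assoc]
  have har : a * r = 0 := by rw [ha, mul_assoc, htr, mul_zero]
  have hra : r * a = 0 := by rw [ha, ← mul_assoc, ← mul_assoc, hrt, zero_mul, zero_mul]
  have haβ : ∀ g, β g a = a := fun g => by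
    rw [ha]
    simp only [map_mul, map_sub, starAlgHom_real_smul, map_one, htβ, hxβ]
  have hφa : φ a = ((0 : ℝ) : ℂ) := by
    have h1 : φ (l • (1 : U)) = (l : ℂ) := by
      rw [← Complex.coe_smul, map_smul, map_one]; simp
    rw [ha, map_mul, map_mul, map_sub, hφx, h1]
    simp
  have htxt : t * x * t = l • 1 + a - l • r := by
    have h1 : t * x * t = a + l • t := by
      rw [ha]
      simp only [mul_sub, sub_mul, mul_smul_comm, smul_mul_assoc, mul_one, htt]
      abel
    rw [h1, ht, smul_sub]
    abel
  have hxt : ‖x - t * x * t‖ ≤ ε / 8 := by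
    have h1 : x - t * x * t = r * x * t + x * r := by
      rw [ht]; simp only [mul_sub, sub_mul, mul_one, one_mul]; abel
    have h2 : ‖r * x‖ ≤ ε / 16 := by
      rw [← norm_star, star_mul, hrs, hx.star_eq]; exact hxr
    have h3 : ‖r * x * t‖ ≤ ε / 16 * 1 := (norm_mul_le _ _).trans
      (mul_le_mul h2 htp.norm_le (norm_nonneg _) (by positivity))
    rw [h1]
    refine (norm_add_le _ _).trans ?_
    linarith
  obtain ⟨F, hF⟩ : ∃ F : ℝ → ℝ, F = fun s => √(max (-s) 0) := ⟨_, rfl⟩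
  have hFc : Continuous F := by rw [hF]; fun_prop
  have hFF : ∀ s, F s * F s = max (-s) 0 := fun s => by
    rw [hF]; exact Real.mul_self_sqrt (le_max_right _ _)
  obtain ⟨h, hh⟩ : ∃ h, h = cfc F a := ⟨_, rfl⟩
  have hh0 : 0 ≤ h := by
    rw [hh, hF]; exact cfc_nonneg fun s _ => Real.sqrt_nonneg _
  have hhs : IsSelfAdjoint h := .of_nonneg hh0
  have hφh : φ h = 0 := by
    rw [hh]; exact map_cfc_eq_zero has hφa hFc (by simp [hF])
  have hhh : h * h = cfc (fun s : ℝ => max (-s) 0) a := by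
    rw [hh, ← cfc_mul ..]
    exact cfc_congr fun s _ => hFF s
  have hhr : h * r = 0 := by
    rw [← CStarRing.star_mul_self_eq_zero_iff, star_mul, hhs.star_eq, hrs]
    have h1 : h * h * r = 0 := by
      rw [hhh, cfc_mul_eq_smul has (t := 0) (C := 1) (by fun_prop) zero_le_one (fun s _ => ?_)
        (by rw [har, zero_smul])]
      · simp
      · simp only [neg_zero, max_self, sub_zero, one_mul]
        rw [abs_of_nonneg (le_max_right _ _)]
        exact max_le (neg_le_abs s) (abs_nonneg s)
    calc r * h * (h * r) = r * (h * h * r) := by simp only [mul_assoc]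
      _ = 0 := by rw [h1, mul_zero]
  have hah : -(h * h) ≤ a := by
    rw [hhh, ← cfc_neg (fun s : ℝ => max (-s) 0) a]
    conv_rhs => rw [← cfc_id' ℝ a]
    exact cfc_mono fun s _ => by linarith [le_max_left (-s) 0]
  have hq1 : ‖q‖ = 1 := by
    have h1 := CStarRing.norm_star_mul_self (x := q)
    rw [hq.isSelfAdjoint.star_eq, hq.isIdempotentElem] at h1
    exact (mul_eq_left₀ (norm_ne_zero_iff.mpr hq0)).mp h1.symm
  obtain ⟨p, hp, hφp, hpr, hpβ, hpa, ⟨u, hu⟩, -⟩ := hT.exists_exact hβ1 hβ hr hrβ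
    (har.trans hra.symm) hφq hφh hq.nonneg hq1 hh0 hhr hδ0
  have hpp : p * p = p := hp.isIdempotentElem
  have he := isStarProjection_orbitSum hβ hp hpβ
  have heβ := fun g => map_orbitSum hβ g p
  set e := orbitSum β p with hedef
  have hee : e * e = e := he.isIdempotentElem
  have hes : star e = e := he.isSelfAdjoint
  have her : e * r = 0 := by
    rw [hedef, orbitSum_mul hrβ, hpr]; simp [orbitSum]
  have hre : r * e = 0 := by
    have := congrArg star her
    rwa [star_mul, hes, hrs, star_zero] at this
  obtain ⟨f, hf⟩ : ∃ f, f = 1 - e := ⟨_, rfl⟩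
  have hfp : IsStarProjection f := hf ▸ he.one_sub
  have hff : f * f = f := hfp.isIdempotentElem
  have hfs : star f = f := hfp.isSelfAdjoint
  have hfe : f * e = 0 := hf ▸ he.one_sub_mul_self
  have hef : e * f = 0 := hf ▸ he.mul_one_sub_self
  have hfr : f * r = r := by rw [hf, sub_mul, her, one_mul, sub_zero]
  have hfβ : ∀ g, β g f = f := fun g => by rw [hf, map_sub, map_one, heβ]
  obtain ⟨c, hc⟩ : ∃ c, c = l • 1 + f * a * f := ⟨_, rfl⟩
  have hcs : IsSelfAdjoint c := by
    rw [isSelfAdjoint_iff, hc]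
    simp only [star_add, star_mul, star_smul, star_one, star_trivial, hfs, has.star_eq, mul_assoc]
  have hcr : c * r = l • r := by
    rw [hc, add_mul, mul_assoc, hfr, mul_assoc, har, mul_zero, add_zero, smul_mul_assoc, one_mul]
  have hce : c * e = l • e := by
    rw [hc, add_mul, mul_assoc, hfe, mul_zero, add_zero, smul_mul_assoc, one_mul]
  have hcβ : ∀ g, β g c = c := fun g => by
    rw [hc]
    simp only [map_add, map_mul, starAlgHom_real_smul, map_one, hfβ, haβ]
  have hθ1 : star (f * h) * (f * h) ≤ u * q * star u + (l / 4) • (1 : U) := by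
    have h1 : star (f * h) * (f * h) = h * h - h * e * h := by
      calc _ = h * (f * f) * h := by rw [star_mul, hfs, hhs.star_eq]; simp only [mul_assoc]
        _ = _ := by rw [hff, hf, mul_sub, sub_mul, mul_one]
    rw [h1]
    exact hu.trans (add_le_add le_rfl (smul_le_smul_of_nonneg_right hδl zero_le_one))
  have hθ2 : l • (1 : U) - f * h * star (f * h) ≤ c := by
    have h1 := hfp.conj_le_conj hah
    have h2 : f * h * star (f * h) = f * (h * h) * f := by
      rw [star_mul, hfs, hhs.star_eq]; simp only [mul_assoc]
    rw [hc, h2, sub_eq_add_neg]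
    refine add_le_add le_rfl ?_
    simpa using h1
  obtain ⟨v₀, hv₀q, hv₀1, hv₀g, hv₀⟩ := exists_dominating_lowerCutoff hcs hq hη0 hηl hθ1 hθ2
    (by norm_num : (0 : ℝ) < 1 / 18)
  have hrg : r * cfc (lowerCutoff η) c = 0 := by
    have h1 := cfc_lowerCutoff_mul_eq_zero hcs hη0 (by linarith : 2 * η ≤ l) hcr
    have := congrArg star h1
    rwa [star_mul, hrs, (cfc_predicate (lowerCutoff η) c : IsSelfAdjoint _).star_eq,
      star_zero] at this
  have hgβ : ∀ g, β g (cfc (lowerCutoff η) c) = cfc (lowerCutoff η) c := fun g => by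
    rw [StarAlgHomClass.map_cfc (β g) _ c (continuous_lowerCutoff η).continuousOn
      (hφa := (hcβ g).symm ▸ hcs), hcβ]
  obtain ⟨v, hvβ, hvr, hv1, hvg, hv⟩ := exists_fixed_average hβ hq hqβ hv₀q hv₀1
    (fun g => by rw [map_mul, hgβ]) hv₀g
  have hrv : r * v = 0 := hv r hrβ (hv₀ r hrg)
  obtain ⟨M, hMs, ⟨M', hM'⟩, hMc, hMe, hMβ⟩ := exists_unit_near_sub_smul hcs hr hη0
    (by linarith : 2 * η ≤ l) hcr hvr hrv hv1 hvg
  have hMe : M * e = l • e := hMe e hce hre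
  have heM : e * M = l • e := by
    have := congrArg star hMe
    rwa [star_mul, hMs.star_eq, hes, star_smul, star_trivial, hes] at this
  obtain ⟨m, hm⟩ : ∃ m : U, M * m = 1 := ⟨↑M'⁻¹, by rw [← hM', M'.mul_inv]⟩
  have hem : e * m = l⁻¹ • e := by
    have h1 : e * M * m = e := by rw [mul_assoc, hm, mul_one]
    rw [heM, smul_mul_assoc] at h1
    rw [← h1, smul_smul, inv_mul_cancel₀ hl.ne', one_smul, h1]
  obtain ⟨z, z', hzs, hpz, hzp, hpz', hzp', hzz, -, hzn⟩ := exists_invertible_in_corner hRR hp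
    (x := p * (l • 1 + a) * p) (by
      rw [isSelfAdjoint_iff]
      simp only [star_add, star_mul, star_smul, star_one, star_trivial, hp.isSelfAdjoint.star_eq,
        has.star_eq, mul_assoc])
    (by rw [mul_assoc, mul_assoc _ p p, hpp, ← mul_assoc, ← mul_assoc, hpp]) hδ0
  have hZs : IsSelfAdjoint (orbitSum β z) := by
    rw [isSelfAdjoint_iff, star_orbitSum, hzs.star_eq]
  have hZe : orbitSum β z * e = orbitSum β z := by
    rw [hedef, orbitSum_mul_orbitSum hβ hpβ hzp hpp, hzp]
  have heZ' : e * orbitSum β z' = orbitSum β z' := by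
    rw [hedef, orbitSum_mul_orbitSum hβ hpβ hpp hpz', hpz']
  have hZZ : orbitSum β z * orbitSum β z' = e := by
    rw [orbitSum_mul_orbitSum hβ hpβ hzp hpz', hzz]
  have hys : IsSelfAdjoint (M - l • e + orbitSum β z) :=
    (hMs.sub ((IsSelfAdjoint.all l).smul he.isSelfAdjoint)).add hZs
  refine ⟨M - l • e + orbitSum β z, hys, ?_, ?_, ?_⟩
  · intro g
    simp only [map_add, map_sub, starAlgHom_real_smul, heβ, map_orbitSum hβ,
      hMβ (β g) (hcβ g) (hrβ g) (hvβ g)]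
  · refine isUnit_of_isSelfAdjoint_of_mul_eq_one hys (z := m * f + orbitSum β z') ?_
    have h1 : (M - l • e) * (m * f) = f := by
      rw [sub_mul, ← mul_assoc, hm, one_mul, smul_mul_assoc, ← mul_assoc, hem, smul_mul_assoc, hef,
        smul_zero, smul_zero, sub_zero]
    have h2 : (M - l • e) * orbitSum β z' = 0 := by
      rw [← heZ', ← mul_assoc, sub_mul, hMe, smul_mul_assoc, hee, sub_self, zero_mul]
    have h3 : orbitSum β z * (m * f) = 0 := by
      rw [← hZe, mul_assoc, ← mul_assoc e, hem, smul_mul_assoc, hef, smul_zero, mul_zero]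
    rw [add_mul, mul_add, mul_add, h1, h2, h3, hZZ, hf]
    abel
  · have h1 : x - (M - l • e + orbitSum β z) = (x - t * x * t) - (M - (c - l • r))
        - (orbitSum β (z - p * (l • 1 + a) * p))
        + (orbitSum β (p * (p * a - a * p)) + f * orbitSum β ((a * p - p * a) * p)) := by
      have h2 : orbitSum β (p * (l • 1 + a) * p) = l • e + orbitSum β (p * a * p) := by
        rw [hedef, ← orbitSum_smul, ← orbitSum_add]
        congr 1
        rw [mul_add, add_mul, mul_smul_comm, smul_mul_assoc, mul_one, hpp]
      have h3 : orbitSum β (p * (p * a - a * p)) = e * a - orbitSum β (p * a * p) := by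
        rw [hedef, orbitSum_mul haβ, ← orbitSum_sub]
        congr 1
        rw [mul_sub, ← mul_assoc, ← mul_assoc, hpp]
      have h4 : f * orbitSum β ((a * p - p * a) * p) = f * a * e := by
        have h5 : (a * p - p * a) * p = a * p - p * a * p := by
          rw [sub_mul, mul_assoc a, hpp]
        have h6 : f * orbitSum β (p * a * p) = 0 := by
          have h7 : e * orbitSum β (p * a * p) = orbitSum β (p * a * p) := by
            have h8 : p * (p * a * p) = p * a * p := by rw [← mul_assoc, ← mul_assoc, hpp]
            rw [hedef, orbitSum_mul_orbitSum hβ hpβ hpp h8, h8]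
          rw [← h7, ← mul_assoc, hfe, zero_mul]
        rw [h5, orbitSum_sub, mul_sub, h6, sub_zero, ← mul_orbitSum haβ, ← mul_assoc]
      rw [orbitSum_sub, h2, h3, h4, htxt, hc, hf]
      simp only [mul_sub, sub_mul, one_mul, mul_one]
      abel
    have h2 : ‖orbitSum β (z - p * (l • 1 + a) * p)‖ ≤ ε / 16 := hnorm _ hzn.le
    have h3 : ‖orbitSum β (p * (p * a - a * p))‖ ≤ ε / 16 := by
      refine hnorm _ ((norm_mul_le _ _).trans ?_)
      have := mul_le_mul hp.norm_le hpa.le (norm_nonneg _) zero_le_one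
      rwa [one_mul] at this
    have h4 : ‖f * orbitSum β ((a * p - p * a) * p)‖ ≤ 1 * (ε / 16) := by
      refine (norm_mul_le _ _).trans (mul_le_mul hfp.norm_le (hnorm _ ((norm_mul_le _ _).trans ?_))
        (norm_nonneg _) zero_le_one)
      rw [norm_sub_rev] at hpa
      have := mul_le_mul hpa.le hp.norm_le (norm_nonneg _) hδ0.le
      rwa [mul_one] at this
    rw [h1]
    have h5 := norm_add_le ((x - t * x * t) - (M - (c - l • r))
        - (orbitSum β (z - p * (l • 1 + a) * p)))
        (orbitSum β (p * (p * a - a * p)) + f * orbitSum β ((a * p - p * a) * p))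
    have h6 := norm_add_le (orbitSum β (p * (p * a - a * p)))
      (f * orbitSum β ((a * p - p * a) * p))
    have h7 := norm_sub_le ((x - t * x * t) - (M - (c - l • r)))
        (orbitSum β (z - p * (l • 1 + a) * p))
    have h8 := norm_sub_le (x - t * x * t) (M - (c - l • r))
    linarith

/-- Invariant self-adjoint elements are approximated by invariant self-adjoint units. -/
theorem HasRokhlinTowers.exists_fixed_unit {φ : U →⋆ₐ[ℂ] ℂ} {β : G → U →⋆ₐ[ℂ] U}
    (hT : HasRokhlinTowers φ β)
    (hRR : ∀ x : U, IsSelfAdjoint x → ∀ ε : ℝ, 0 < ε →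
      ∃ y : U, IsSelfAdjoint y ∧ IsUnit y ∧ ‖x - y‖ < ε)
    (hβ1 : ∀ x, β 1 x = x) (hβ : ∀ g h x, β (g * h) x = β g (β h x))
    {x : U} (hx : IsSelfAdjoint x) (hxβ : ∀ g, β g x = x) {ε : ℝ} (hε : 0 < ε) :
    ∃ y : U, IsSelfAdjoint y ∧ (∀ g, β g y = y) ∧ IsUnit y ∧ ‖x - y‖ < ε := by
  obtain ⟨l, hl⟩ : ∃ l : ℝ, φ x = (l : ℂ) := by
    have h1 : IsSelfAdjoint (φ x) := hx.map φ
    exact ⟨(φ x).re, (Complex.conj_eq_iff_re.mp h1).symm⟩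
  rcases le_or_gt 0 l with h | h
  · have h1 : φ (x + (ε / 2) • (1 : U)) = ((l + ε / 2 : ℝ) : ℂ) := by
      rw [map_add, hl, ← Complex.coe_smul, map_smul, map_one]; simp
    obtain ⟨y, hy, hyβ, hyu, hxy⟩ := hT.exists_fixed_unit_of_pos hRR hβ1 hβ
      (hx.add ((IsSelfAdjoint.all (ε / 2)).smul (IsSelfAdjoint.one U)))
      (fun g => by rw [map_add, hxβ, starAlgHom_real_smul, map_one])
      (by linarith : 0 < l + ε / 2) h1 (half_pos hε)
    refine ⟨y, hy, hyβ, hyu, ?_⟩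
    have h2 : x - y = (x + (ε / 2) • (1 : U) - y) - (ε / 2) • (1 : U) := by abel
    have h3 : ‖(ε / 2) • (1 : U)‖ ≤ ε / 2 * 1 := by
      rw [norm_smul, Real.norm_eq_abs, abs_of_pos (half_pos hε)]
      exact mul_le_mul_of_nonneg_left (IsStarProjection.norm_le 1 (.one U)) (half_pos hε).le
    rw [h2]
    refine lt_of_le_of_lt (norm_sub_le _ _) ?_
    linarith
  · obtain ⟨y, hy, hyβ, hyu, hxy⟩ := hT.exists_fixed_unit_of_pos hRR hβ1 hβ hx.neg
      (fun g => by rw [map_neg, hxβ]) (neg_pos.mpr h) (by rw [map_neg, hl]; simp) hε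
    refine ⟨-y, hy.neg, fun g => by rw [map_neg, hyβ], hyu.neg, ?_⟩
    rw [show x - -y = -(-x - y) by abel, norm_neg]
    exact hxy

end Core

section Unitization

open Unitization

variable {A : Type*} [NonUnitalCStarAlgebra A]

/-- The character of the unitization that vanishes on the algebra. -/
noncomputable def scalarPart (A : Type*) [NonUnitalCStarAlgebra A] : Unitization ℂ A →⋆ₐ[ℂ] ℂ :=
  { fstHom ℂ A with map_star' := fst_star }

@[simp]
lemma scalarPart_apply (x : Unitization ℂ A) : scalarPart A x = x.fst := rfl

lemma eq_inr_of_scalarPart_eq_zero {x : Unitization ℂ A} (hx : scalarPart A x = 0) :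
    x = (x.snd : Unitization ℂ A) := by
  rw [scalarPart_apply] at hx
  ext <;> simp [hx]

lemma inr_mul_sub_mul_inr (p : A) (x : Unitization ℂ A) :
    (p : Unitization ℂ A) * x - x * p = ((p * x.snd - x.snd * p : A) : Unitization ℂ A) := by
  induction x with
  | inl_add_inr c a =>
    simp [mul_add, add_mul, inr_mul_inl, inl_mul_inr]

lemma inr_le_inr_cutPos_add {c : A} (hc : IsSelfAdjoint c) {ε : ℝ} (hε : 0 < ε) :
    (c : Unitization ℂ A) ≤ (cutPos c ε : A) + ε • (1 : Unitization ℂ A) := by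
  have hc' : IsSelfAdjoint (c : Unitization ℂ A) := hc.inr ℂ
  rw [cutPos, real_cfcₙ_eq_cfc_inr c (fun t : ℝ => max (t - ε) 0) (by simp [hε.le]),
    ← Algebra.algebraMap_eq_smul_one, ← cfc_const ε (c : Unitization ℂ A), ← cfc_add ..]
  conv_lhs => rw [← cfc_id' ℝ (c : Unitization ℂ A)]
  exact cfc_mono fun t _ => by linarith [le_max_left (t - ε) 0]

variable [PartialOrder A] [StarOrderedRing A] {G : Type*} [Group G] [Fintype G]

lemma TracialRokhlinProperty.hasRokhlinTowers {α : G → A ≃⋆ₐ[ℂ] A}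
    (h : TracialRokhlinProperty α) :
    HasRokhlinTowers (scalarPart A) fun g => starMap (α g : A →⋆ₙₐ[ℂ] A) := by
  classical
  intro a b ε hε x y hφx hφy hx hy hx1
  obtain ⟨x, rfl⟩ : ∃ x' : A, x = x' := ⟨_, eq_inr_of_scalarPart_eq_zero hφx⟩
  obtain ⟨y, rfl⟩ : ∃ y' : A, y = y' := ⟨_, eq_inr_of_scalarPart_eq_zero hφy⟩
  rw [inr_nonneg_iff] at hx hy
  rw [norm_inr] at hx1
  obtain ⟨p, hp, hpp, hpF, hpα, ⟨v, hv⟩, hpx⟩ :=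
    h {a.snd, b.snd} (ε / 2) (half_pos hε) x y hx hy hx1
  have hsum : ∑ g, (p g : Unitization ℂ A) = ((∑ g, p g : A) : Unitization ℂ A) :=
    (map_sum (inrNonUnitalStarAlgHom ℂ A) p Finset.univ).symm
  refine ⟨fun g => (p g : Unitization ℂ A), fun g => ⟨?_, (hp g).1.inr ℂ⟩,
    fun g => fst_inr ℂ (p g),
    fun g k hgk => ?_, fun g => ?_, fun g => ?_, fun g k => ?_, ?_, ?_⟩
  · rw [IsIdempotentElem, ← inr_mul, (hp g).2]
  · rw [← inr_mul, hpp g k hgk, inr_zero]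
  · rw [inr_mul_sub_mul_inr, norm_inr]
    exact (hpF _ (by simp) g).trans (half_lt_self hε)
  · rw [inr_mul_sub_mul_inr, norm_inr]
    exact (hpF _ (by simp) g).trans (half_lt_self hε)
  · rw [starMap_inr, ← inr_sub, norm_inr]
    exact (hpα g k).trans (half_lt_self hε)
  · obtain ⟨n, hn⟩ := (hv.eventually (gt_mem_nhds (half_pos hε))).exists
    refine ⟨v n, ?_⟩
    have hps : IsSelfAdjoint (∑ g, p g) := isSelfAdjoint_sum _ fun g _ => (hp g).1
    have hys : IsSelfAdjoint y := .of_nonneg hy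
    have hc : IsSelfAdjoint (y * y - y * (∑ g, p g) * y) := by
      rw [isSelfAdjoint_iff]
      simp only [star_sub, star_mul, hys.star_eq, hps.star_eq, mul_assoc]
    have h1 := inr_le_inr_cutPos_add hc (half_pos hε)
    set d := cutPos (y * y - y * (∑ g, p g) * y) (ε / 2) with hd
    have hds : IsSelfAdjoint d := cfcₙ_predicate _ _
    have hvs : IsSelfAdjoint (v n * x * star (v n)) := (IsSelfAdjoint.of_nonneg hx).conjugate _
    have h2 := ((hds.sub hvs).inr ℂ).le_smul_one (μ := ε / 2) (by rw [norm_inr]; exact hn.le)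
    rw [inr_sub, sub_le_iff_le_add'] at h2
    simp only [hsum, ← inr_mul, ← inr_sub, ← inr_star]
    calc _ ≤ _ := h1
      _ ≤ _ := add_le_add h2 le_rfl
      _ = _ := by rw [add_assoc, ← add_smul, add_halves]
  · simp only [hsum, ← inr_mul, norm_inr]
    linarith

end Unitization

/-- Theorem A(2) (fixed point algebra part): if `A` is a simple σ-unital C*-algebra with real
rank zero and `α` is an action of a finite group `G` on `A` with the tracial Rokhlin property,
then the fixed point algebra `A^α` has real rank zero. -/
theorem realRankZero_fixedPointAlgebra
    {A : Type*} [NonUnitalCStarAlgebra A] [PartialOrder A] [StarOrderedRing A]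
    {G : Type*} [Group G] [Fintype G]
    (hA : IsSimpleCStarAlgebra A) (hσ : SigmaUnital A) (hRR : RealRankZero A)
    (α : G → A ≃⋆ₐ[ℂ] A) (hα : ∀ g h : G, ∀ a : A, α (g * h) a = α g (α h a))
    (hTRP : TracialRokhlinProperty α) :
    RealRankZero ↥(fixedPointAlgebra α) := by
  intro x hx ε hε
  let β : G → Unitization ℂ A →⋆ₐ[ℂ] Unitization ℂ A :=
    fun g => Unitization.starMap (α g : A →⋆ₙₐ[ℂ] A)
  have hα1 : ∀ a, α 1 a = a := fun a => (α 1).injective (by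
    change α 1 (α 1 a) = α 1 a
    rw [← hα, one_mul])
  have hβa : ∀ g c (a : A), β g (Unitization.inl c + (a : Unitization ℂ A)) =
      Unitization.inl c + ((α g a : A) : Unitization ℂ A) := by
    intro g c a
    rw [map_add, Unitization.starMap_inl, Unitization.starMap_inr]
    rfl
  have hβ1 : ∀ y, β 1 y = y := fun y => by
    induction y with
    | inl_add_inr c a => rw [hβa, hα1]
  have hβ : ∀ g h y, β (g * h) y = β g (β h y) := fun g h y => by
    induction y with
    | inl_add_inr c a => rw [hβa, hβa, hβa, hα]
  let ι : Unitization ℂ (fixedPointAlgebra α) →⋆ₐ[ℂ] Unitization ℂ A :=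
    Unitization.starMap (NonUnitalStarSubalgebraClass.subtype (fixedPointAlgebra α))
  have hι : Function.Injective ι := Unitization.starMap_injective Subtype.val_injective
  have hιa : ∀ c (a : fixedPointAlgebra α),
      ι (Unitization.inl c + (a : Unitization ℂ (fixedPointAlgebra α))) = Unitization.inl c + ((a : A) : Unitization ℂ A) := by
    intro c a
    rw [map_add, Unitization.starMap_inl, Unitization.starMap_inr]
    rfl
  have hιβ : ∀ y g, β g (ι y) = ι y := fun y g => by
    induction y with
    | inl_add_inr c a => rw [hιa, hβa, a.2 g]
  have hfix : ∀ y : Unitization ℂ A, (∀ g, β g y = y) → ∃ z, ι z = y := fun y hy => by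
    induction y with
    | inl_add_inr c a =>
      refine ⟨Unitization.inl c + ((⟨a, fun g => ?_⟩ : fixedPointAlgebra α) :
        Unitization ℂ (fixedPointAlgebra α)), hιa _ _⟩
      have h1 := hy g
      rw [hβa] at h1
      exact Unitization.inr_injective (add_left_cancel h1)
  obtain ⟨y, hys, hyβ, ⟨u, rfl⟩, hxy⟩ := hTRP.hasRokhlinTowers.exists_fixed_unit hRR hβ1 hβ
    (hx.map ι) (hιβ x) hε
  obtain ⟨z, hz⟩ := hfix _ hyβ
  obtain ⟨w, hw⟩ := hfix (↑u⁻¹ : Unitization ℂ A) fun g => by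
    have h1 : β g ↑u⁻¹ * u = 1 := by
      conv_lhs => rw [← hyβ g]
      rw [← map_mul, u.inv_mul, map_one]
    exact Units.eq_inv_of_mul_eq_one_right h1
  refine ⟨z, hι ?_, ⟨⟨z, w, hι ?_, hι ?_⟩, rfl⟩, ?_⟩
  · rw [map_star, hz, hys.star_eq]
  · rw [map_mul, hz, hw, u.mul_inv, map_one]
  · rw [map_mul, hz, hw, u.inv_mul, map_one]
  · rw [← NonUnitalStarAlgHom.norm_map ι hι, map_sub, hz]
    exact hxy
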